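/- Let n ≥ 2, p ≤ 2 − n, and 0 < τ1 < τ2. Suppose f : S^{n-1} → ℝ satisfies τ1 < f(u) < τ2 for all u ∈ S^{n-1}, and K ∈ K_0^n is a solution of the L_p Minkowski problem dS_{K,p} = f dH^{n-1}. Then o lies in the interior of K; consequently K is smooth and ∂K contains no nondegenerate segment. -/

import Mathlib

open MeasureTheory Set
open scoped ENNReal NNReal RealInnerProductSpace

noncomputable section

/-- Support function of a set `K`. -/
def suppFn {n : ℕ} (K : Set (EuclideanSpace ℝ (Fin n))) (u : EuclideanSpace ℝ (Fin n)) : ℝ :=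
  sSup ((fun y => ⟪u, y⟫) '' K)

/-- Face of `K` with outer normal `u`. -/
def face {n : ℕ} (K : Set (EuclideanSpace ℝ (Fin n))) (u : EuclideanSpace ℝ (Fin n)) :
    Set (EuclideanSpace ℝ (Fin n)) :=
  {z ∈ K | ⟪z, u⟫ = suppFn K u}

/-- Normal cone of `K` at `z`. -/
def normalCone {n : ℕ} (K : Set (EuclideanSpace ℝ (Fin n))) (z : EuclideanSpace ℝ (Fin n)) :
    Set (EuclideanSpace ℝ (Fin n)) :=
  {u | ∀ y ∈ K, ⟪u, y⟫ ≤ ⟪u, z⟫}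

/-- The unit sphere `S^{n-1}` in `ℝ^n`. -/
def unitSphere (n : ℕ) : Set (EuclideanSpace ℝ (Fin n)) :=
  Metric.sphere (0 : EuclideanSpace ℝ (Fin n)) 1

/-- Surface area measure of `K` evaluated on `ω`:
`S_K(ω) = H^{n-1}(⋃_{u ∈ ω} F(K,u))`. -/
def surfMeas {n : ℕ} (K : Set (EuclideanSpace ℝ (Fin n)))
    (ω : Set (EuclideanSpace ℝ (Fin n))) : ℝ≥0∞ :=
  μH[(n : ℝ) - 1] (⋃ u ∈ ω, face K u)

/-- `K ∈ 𝒦₀ⁿ`: compact convex with nonempty interior, containing the origin. -/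
def IsConvexBody0 {n : ℕ} (K : Set (EuclideanSpace ℝ (Fin n))) : Prop :=
  IsCompact K ∧ Convex ℝ K ∧ (interior K).Nonempty ∧ (0 : EuclideanSpace ℝ (Fin n)) ∈ K

/-- `K` is a solution of the `L_p` Minkowski problem `dS_{K,p} = f dH^{n-1}`. -/
def IsLpSolution {n : ℕ} (p : ℝ) (f : EuclideanSpace ℝ (Fin n) → ℝ)
    (K : Set (EuclideanSpace ℝ (Fin n))) : Prop :=
  μH[(n : ℝ) - 1] {u ∈ unitSphere n | suppFn K u = 0} = 0 ∧
  ∀ ω : Set (EuclideanSpace ℝ (Fin n)), MeasurableSet ω →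
    ω ⊆ {u ∈ unitSphere n | 0 < suppFn K u} →
    surfMeas K ω
      = ∫⁻ u in ω, ENNReal.ofReal ((n : ℝ) * f u * suppFn K u ^ (p - 1)) ∂μH[(n : ℝ) - 1]

/-- `x` is a smooth boundary point: the normal cone spans a one-dimensional space. -/
def IsSmoothPt {n : ℕ} (K : Set (EuclideanSpace ℝ (Fin n)))
    (x : EuclideanSpace ℝ (Fin n)) : Prop :=
  Module.finrank ℝ (Submodule.span ℝ (normalCone K x)) = 1

/-- `K` is smooth: every boundary point is a smooth point. -/
def IsSmoothBody {n : ℕ} (K : Set (EuclideanSpace ℝ (Fin n))) : Prop :=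
  ∀ x ∈ frontier K, IsSmoothPt K x

/-- Subgradient of `v` at `x` relative to the domain `Ω`. -/
def subgrad {n : ℕ} (Ω : Set (EuclideanSpace ℝ (Fin n))) (v : EuclideanSpace ℝ (Fin n) → ℝ)
    (x : EuclideanSpace ℝ (Fin n)) : Set (EuclideanSpace ℝ (Fin n)) :=
  {z | ∀ y ∈ Ω, v x + ⟪z, y - x⟫ ≤ v y}

/-- Monge–Ampère measure of `v` (relative to domain `Ω`) evaluated on `ω`. -/
def maMeasure {n : ℕ} (Ω : Set (EuclideanSpace ℝ (Fin n))) (v : EuclideanSpace ℝ (Fin n) → ℝ)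
    (ω : Set (EuclideanSpace ℝ (Fin n))) : ℝ≥0∞ :=
  μH[(n : ℝ)] (⋃ x ∈ ω, subgrad Ω v x)

/-- Hessian matrix of `v : ℝ^n → ℝ` at `x`. -/
def hessMatrix {n : ℕ} (v : EuclideanSpace ℝ (Fin n) → ℝ) (x : EuclideanSpace ℝ (Fin n)) :
    Matrix (Fin n) (Fin n) ℝ :=
  Matrix.of fun i j =>
    fderiv ℝ (fun y => fderiv ℝ v y (EuclideanSpace.single j 1)) x (EuclideanSpace.single i 1)

section Helpers
open Filter Topology Metric


abbrev Eu (n : ℕ) := EuclideanSpace ℝ (Fin n)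

/-- The truncated cone with apex at the origin over a set. -/
def coneS {n : ℕ} (P : Set (Eu n)) : Set (Eu n) :=
  {z | ∃ s ∈ Icc (0:ℝ) 1, ∃ x ∈ P, z = s • x}

lemma coneS_mono {n : ℕ} {P Q : Set (Eu n)} (h : P ⊆ Q) : coneS P ⊆ coneS Q := by
  rintro z ⟨s, hs, x, hx, rfl⟩
  exact ⟨s, hs, x, h hx, rfl⟩

lemma coneS_compact {n : ℕ} {P : Set (Eu n)} (h : IsCompact P) : IsCompact (coneS P) := by
  have : coneS P = (fun q : ℝ × Eu n => q.1 • q.2) '' (Icc (0:ℝ) 1 ×ˢ P) := by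
    ext z
    constructor
    · rintro ⟨s, hs, x, hx, rfl⟩
      exact ⟨(s, x), ⟨hs, hx⟩, rfl⟩
    · rintro ⟨⟨s, x⟩, ⟨hs, hx⟩, rfl⟩
      exact ⟨s, hs, x, hx, rfl⟩
  rw [this]
  exact (isCompact_Icc.prod h).image (by fun_prop)

lemma cone_small {n : ℕ} (hn : 2 ≤ n) {R d : ℝ} (hd : 0 < d) (hdR : d ≤ R)
    {t : Set (Eu n)} (ht : t ⊆ closedBall 0 R) (hdiam : ∀ x ∈ t, ∀ y ∈ t, dist x y ≤ d) :
    volume (coneS t) ≤ ENNReal.ofReal (3 * R * 2 ^ n * volume.real (ball (0 : Eu n) 1) * d ^ (n - 1)) := by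
  rcases t.eq_empty_or_nonempty with rfl | ⟨x, hx⟩
  · have : coneS (∅ : Set (Eu n)) = ∅ := by
      ext z; simp [coneS]
    rw [this]; simp
  have hR : 0 < R := lt_of_lt_of_le hd hdR
  set N := ⌈R / d⌉₊ with hN
  have hN1 : R / d ≤ N := Nat.le_ceil _
  have hN2 : (N:ℝ) < R / d + 1 := Nat.ceil_lt_add_one (by positivity)
  have hNpos : 0 < (N:ℝ) := lt_of_lt_of_le (by positivity) hN1
  have hxR : ‖x‖ ≤ R := by simpa using ht hx
  have hcov : coneS t ⊆ ⋃ k ∈ Finset.range (N+1), closedBall (((k:ℝ)/N) • x) (2*d) := by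
    rintro z ⟨s, ⟨hs0, hs1⟩, y, hy, rfl⟩
    have hk1 : (⌊s * N⌋₊ : ℝ) ≤ s * N := Nat.floor_le (by positivity)
    have hk2 : s * N < ⌊s * N⌋₊ + 1 := Nat.lt_floor_add_one _
    have hkN : ⌊s * N⌋₊ < N + 1 := by
      have : (⌊s * N⌋₊ : ℝ) ≤ N := by nlinarith
      have : ⌊s * N⌋₊ ≤ N := by exact_mod_cast this
      omega
    simp only [mem_iUnion]
    refine ⟨⌊s * N⌋₊, Finset.mem_range.2 hkN, ?_⟩
    set k := ⌊s * N⌋₊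
    rw [mem_closedBall, dist_eq_norm]
    have e : s • y - ((k:ℝ)/N) • x = s • (y - x) + (s - (k:ℝ)/N) • x := by
      rw [smul_sub, sub_smul]; abel
    rw [e]
    have h1 : ‖s • (y - x)‖ ≤ d := by
      rw [norm_smul, Real.norm_of_nonneg hs0, ← dist_eq_norm]
      have := hdiam y hy x hx
      have := dist_nonneg (x := y) (y := x)
      nlinarith
    have h2 : ‖(s - (k:ℝ)/N) • x‖ ≤ d := by
      rw [norm_smul, Real.norm_of_nonneg]
      · have a1 : s - (k:ℝ)/N ≤ 1 / N := by
          rw [sub_le_iff_le_add, ← add_div, le_div_iff₀ hNpos]; linarith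
        have a2 : (1 / (N:ℝ)) * R ≤ d := by
          rw [one_div, inv_mul_le_iff₀ hNpos]
          exact (div_le_iff₀ hd).1 hN1
        have a3 : 0 ≤ 1 / (N:ℝ) := by positivity
        calc (s - (k:ℝ)/N) * ‖x‖ ≤ (1/N) * R := by
              apply mul_le_mul a1 hxR (norm_nonneg _) a3
          _ ≤ d := a2
      · rw [sub_nonneg, div_le_iff₀ hNpos]; exact hk1
    calc _ ≤ _ := norm_add_le _ _
      _ ≤ 2 * d := by linarith
  calc volume (coneS t) ≤ volume (⋃ k ∈ Finset.range (N+1), closedBall (((k:ℝ)/N) • x) (2*d)) :=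
        measure_mono hcov
    _ ≤ ∑ k ∈ Finset.range (N+1), volume (closedBall (((k:ℝ)/N) • x) (2*d)) :=
        measure_biUnion_finset_le _ _
    _ = ∑ k ∈ Finset.range (N+1), ENNReal.ofReal ((2*d)^n * volume.real (ball (0 : Eu n) 1)) := by
        refine Finset.sum_congr rfl fun k _ => ?_
        rw [Measure.addHaar_closedBall _ _ (by positivity), ENNReal.ofReal_mul (by positivity)]
        simp [Measure.real, ENNReal.ofReal_toReal measure_ball_lt_top.ne]
    _ = ENNReal.ofReal ((N+1) * ((2*d)^n * volume.real (ball (0 : Eu n) 1))) := by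
        rw [Finset.sum_const, Finset.card_range, nsmul_eq_mul,
          show ((N:ℝ)+1) = ((N+1 : ℕ):ℝ) by push_cast; rfl,
          ENNReal.ofReal_mul (p := ((N+1 : ℕ):ℝ)) (by positivity), ENNReal.ofReal_natCast]
    _ ≤ _ := by
        apply ENNReal.ofReal_le_ofReal
        have : (N:ℝ) + 1 ≤ 3 * R / d := by
          have : 1 ≤ R / d := (one_le_div hd).2 hdR
          have e : 3 * R / d = 3 * (R / d) := by ring
          linarith
        have e2 : d ^ n = d * d ^ (n-1) := by
          rw [← pow_succ']; congr 1; omega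
        calc ((N:ℝ)+1) * ((2*d)^n * volume.real (ball (0 : Eu n) 1))
            ≤ (3 * R / d) * ((2*d)^n * volume.real (ball (0 : Eu n) 1)) := by
              gcongr
          _ = _ := by
              rw [mul_pow, e2]; field_simp

lemma cone_le_haus {n : ℕ} (hn : 2 ≤ n) {R : ℝ} (hR : 0 < R) :
    ∃ C : ℝ≥0∞, C ≠ 0 ∧ C ≠ ∞ ∧ ∀ P : Set (Eu n), P ⊆ closedBall 0 R →
      volume (coneS P) ≤ C * μH[(n:ℝ) - 1] P := by
  set A : ℝ := 3 * R * 2 ^ n * volume.real (ball (0 : Eu n) 1) with hA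
  have hApos : 0 < A := by
    have : 0 < volume.real (ball (0 : Eu n) 1) := by
      apply ENNReal.toReal_pos
      · exact (measure_ball_pos _ _ one_pos).ne'
      · exact measure_ball_lt_top.ne
    positivity
  let ν : OuterMeasure (Eu n) :=
    { measureOf := fun P => volume (coneS (P ∩ closedBall 0 R))
      empty := by
        have : coneS ((∅ : Set (Eu n)) ∩ closedBall 0 R) = ∅ := by ext z; simp [coneS]
        rw [this]; simp
      mono := fun {s t} h => measure_mono (coneS_mono (inter_subset_inter_left _ h))
      iUnion_nat := fun s _ => by
        refine le_trans (measure_mono ?_) (measure_iUnion_le _)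
        rintro z ⟨c, hc, x, ⟨hx, hxR⟩, rfl⟩
        obtain ⟨i, hi⟩ := mem_iUnion.1 hx
        exact mem_iUnion.2 ⟨i, c, hc, x, ⟨hi, hxR⟩, rfl⟩ }
  have hAne : ENNReal.ofReal A ≠ 0 := by simpa using hApos
  have key : ν ≤ OuterMeasure.mkMetric (ENNReal.ofReal A • fun r : ℝ≥0∞ => r ^ ((n:ℝ) - 1)) := by
    apply OuterMeasure.le_mkMetric _ ν (ENNReal.ofReal R) (by simpa using hR)
    intro s hs
    have hfin : Metric.ediam s ≠ ∞ := ne_top_of_le_ne_top ENNReal.ofReal_ne_top hs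
    have hsd : ∀ d : ℝ, 0 < d → d ≤ R → Metric.ediam s ≤ ENNReal.ofReal d →
        ν s ≤ ENNReal.ofReal (A * d ^ (n-1)) := by
      intro d hd hdR hsd
      apply cone_small hn hd hdR inter_subset_right
      intro x hx y hy
      have := (Metric.edist_le_ediam_of_mem hx.1 hy.1).trans hsd
      rw [edist_dist] at this
      exact (ENNReal.ofReal_le_ofReal_iff hd.le).1 this
    show ν s ≤ ENNReal.ofReal A * Metric.ediam s ^ ((n:ℝ) - 1)
    have hexp : (n:ℝ) - 1 = ((n-1 : ℕ) : ℝ) := by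
      rw [Nat.cast_sub (by omega)]; simp
    rcases eq_or_ne (Metric.ediam s) 0 with h0 | h0
    · have : Tendsto (fun d : ℝ => ENNReal.ofReal (A * d ^ (n-1))) (𝓝[>] 0) (𝓝 0) := by
        have : Tendsto (fun d : ℝ => ENNReal.ofReal (A * d ^ (n-1))) (𝓝 0) (𝓝 (ENNReal.ofReal (A * 0 ^ (n-1)))) := by
          exact (ENNReal.continuous_ofReal.comp (by fun_prop)).tendsto _
        rw [zero_pow (by omega)] at this
        simp only [mul_zero, ENNReal.ofReal_zero] at this
        exact this.mono_left nhdsWithin_le_nhds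
      have hz : ν s ≤ 0 := by
        apply ge_of_tendsto this
        filter_upwards [Ioc_mem_nhdsGT hR] with d hd
        apply hsd d hd.1 hd.2
        rw [h0]; exact zero_le
      exact hz.trans zero_le
    · have hd : 0 < (Metric.ediam s).toReal := ENNReal.toReal_pos h0 hfin
      have := hsd _ hd (ENNReal.toReal_le_of_le_ofReal hR.le hs) (by rw [ENNReal.ofReal_toReal hfin])
      refine this.trans (le_of_eq ?_)
      rw [ENNReal.ofReal_mul hApos.le, hexp, ENNReal.rpow_natCast, ENNReal.ofReal_pow hd.le,
        ENNReal.ofReal_toReal hfin]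
  rw [OuterMeasure.mkMetric_smul _ ENNReal.ofReal_ne_top hAne] at key
  refine ⟨ENNReal.ofReal A, hAne, ENNReal.ofReal_ne_top, fun P hP => ?_⟩
  have h := key P
  have h2 : ν P = volume (coneS P) := by
    show volume (coneS (P ∩ closedBall 0 R)) = _
    rw [inter_eq_left.2 hP]
  rw [h2] at h
  refine h.trans (le_of_eq ?_)
  rw [smul_apply, smul_eq_mul]
  rw [Measure.hausdorffMeasure, ← OuterMeasure.coe_mkMetric]


lemma ball_vol_pos (n : ℕ) : 0 < volume.real (ball (0 : Eu n) 1) := by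
  apply ENNReal.toReal_pos
  · exact (measure_ball_pos _ _ one_pos).ne'
  · exact measure_ball_lt_top.ne

lemma tube_lower {n : ℕ} (hn : 2 ≤ n) {K : Set (Eu n)} (hc : Convex ℝ K) {r R : ℝ}
    (hr : 0 < r) (hR : 0 < R) (hrK : ball 0 r ⊆ K) (hKR : K ⊆ closedBall 0 R) :
    ∃ c : ℝ, 0 < c ∧ ∀ x ∈ frontier K, ∀ δ, 0 < δ → δ ≤ r →
      ENNReal.ofReal (c * δ ^ (n - 1)) ≤ volume (coneS (frontier K ∩ closedBall x δ)) := by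
  have hnt : Nontrivial (Eu n) := by
    have : Nonempty (Fin n) := ⟨⟨0, by omega⟩⟩
    infer_instance
  have hK0 : K ∈ 𝓝 0 := Filter.mem_of_superset (ball_mem_nhds _ hr) hrK
  set q : ℝ := r / (4 * (r + R)) with hq
  have hqpos : 0 < q := by positivity
  refine ⟨r * q ^ (n-1) * volume.real (ball (0 : Eu n) 1) / 8, by have := ball_vol_pos n; positivity, ?_⟩
  intro x hx δ hδ hδr
  set ρ := q * δ with hρ
  have hρpos : 0 < ρ := by positivity
  have hρr : ρ / r ≤ 1/4 := by
    rw [hρ, hq, div_le_iff₀ hr, div_mul_eq_mul_div, div_le_iff₀ (by positivity)]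
    nlinarith
  have hρδ : 4 * (ρ + ρ / r * R) = δ := by
    rw [hρ, hq]; field_simp
  have hgx : gauge K x = 1 := (gauge_eq_one_iff_mem_frontier hc hK0).2 hx
  have hxr : r ≤ ‖x‖ := by
    have := mul_gauge_le_norm (x := x) hrK
    rw [hgx] at this; linarith
  have hxR : ‖x‖ ≤ R := by
    have : x ∈ closure K := hx.1
    have := closure_minimal hKR isClosed_closedBall this
    simpa using this
  have hlip : LipschitzWith (Real.toNNReal r)⁻¹ (gauge K) :=
    hc.lipschitzWith_gauge (Real.toNNReal_pos.2 hr) (by rwa [Real.coe_toNNReal r hr.le])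
  have hsub : ∀ s : ℝ, 1/2 ≤ s → s ≤ 3/4 → ball (s • x) ρ ⊆ coneS (frontier K ∩ closedBall x δ) := by
    intro s hs1 hs2 z hz
    rw [mem_ball] at hz
    have hg : |gauge K z - s| ≤ ρ / r := by
      have h1 := hlip.dist_le_mul z (s • x)
      rw [gauge_smul_of_nonneg (by linarith), hgx, smul_eq_mul, mul_one, Real.dist_eq] at h1
      refine h1.trans ?_
      rw [NNReal.coe_inv, Real.coe_toNNReal r hr.le, div_eq_inv_mul]
      gcongr
    set g := gauge K z with hgdef
    have hg' := abs_le.1 hg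
    have hgpos : 1/4 ≤ g := by linarith
    have hg1 : g ≤ 1 := by linarith
    have hg0 : 0 < g := by linarith
    refine ⟨g, ⟨hg0.le, hg1⟩, g⁻¹ • z, ⟨?_, ?_⟩, ?_⟩
    · rw [← gauge_eq_one_iff_mem_frontier hc hK0, gauge_smul_of_nonneg (by positivity), smul_eq_mul,
        ← hgdef, inv_mul_cancel₀ hg0.ne']
    · rw [mem_closedBall, dist_eq_norm]
      have e : g⁻¹ • z - x = g⁻¹ • ((z - s • x) + (s - g) • x) := by
        rw [smul_add, smul_sub, smul_smul, smul_smul, mul_sub, inv_mul_cancel₀ hg0.ne', sub_smul, one_smul]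
        abel
      rw [e, norm_smul, Real.norm_of_nonneg (by positivity)]
      have h1 : ‖(z - s • x) + (s - g) • x‖ ≤ ρ + ρ / r * R := by
        refine (norm_add_le _ _).trans (add_le_add ?_ ?_)
        · rw [← dist_eq_norm]; exact hz.le
        · rw [norm_smul, Real.norm_eq_abs, abs_sub_comm]
          gcongr
      have h2 : g⁻¹ ≤ 4 := by
        rw [inv_le_comm₀ hg0 (by norm_num)]; linarith
      calc g⁻¹ * _ ≤ 4 * (ρ + ρ / r * R) := by gcongr
        _ = δ := hρδ
    · rw [smul_smul, mul_inv_cancel₀ hg0.ne', one_smul]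
  set N := ⌊r / (8 * ρ)⌋₊ + 1 with hN
  have hNl : r / (8 * ρ) ≤ N := by
    rw [hN]; push_cast; exact (Nat.lt_floor_add_one _).le
  set c : ℕ → Eu n := fun k => (1/2 + (k:ℝ) * (2 * ρ / r)) • x with hcdef
  have hcov : (⋃ k ∈ Finset.range N, ball (c k) ρ) ⊆ coneS (frontier K ∩ closedBall x δ) := by
    intro z hz
    simp only [mem_iUnion] at hz
    obtain ⟨k, hk, hz⟩ := hz
    refine hsub _ ?_ ?_ hz
    · have : 0 ≤ (k:ℝ) * (2 * ρ / r) := by positivity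
      linarith
    · have hk' : k ≤ ⌊r / (8 * ρ)⌋₊ := by have := Finset.mem_range.1 hk; omega
      have : (k:ℝ) ≤ r / (8 * ρ) := (Nat.le_floor_iff (by positivity)).1 hk'
      have : (k:ℝ) * (2 * ρ / r) ≤ r / (8 * ρ) * (2 * ρ / r) := by gcongr
      have e : r / (8 * ρ) * (2 * ρ / r) = 1/4 := by field_simp; norm_num
      linarith
  have hdisj : ∀ i j : ℕ, i < j → Disjoint (ball (c i) ρ) (ball (c j) ρ) := by
    intro i j hij
    apply ball_disjoint_ball
    rw [dist_eq_norm, hcdef]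
    simp only
    rw [← sub_smul, norm_smul, Real.norm_eq_abs, abs_sub_comm, abs_of_nonneg]
    · have h1 : (i:ℝ) + 1 ≤ j := by exact_mod_cast hij
      have h2 : 2 * ρ / r ≤ (1 / 2 + (j:ℝ) * (2 * ρ / r) - (1 / 2 + i * (2 * ρ / r))) := by
        have : 0 < 2 * ρ / r := by positivity
        nlinarith
      calc ρ + ρ = 2 * ρ / r * r := by field_simp; ring
        _ ≤ _ := mul_le_mul h2 hxr hr.le (le_trans (by positivity) h2)
    · have : (i:ℝ) ≤ j := by exact_mod_cast hij.le
      have h3 : 0 < 2 * ρ / r := by positivity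
      nlinarith
  have hdisj' : (↑(Finset.range N) : Set ℕ).PairwiseDisjoint (fun k => ball (c k) ρ) := by
    intro i _ j _ hij
    rcases lt_or_gt_of_ne hij with h | h
    · exact hdisj i j h
    · exact (hdisj j i h).symm
  calc ENNReal.ofReal (r * q ^ (n-1) * volume.real (ball (0 : Eu n) 1) / 8 * δ ^ (n - 1))
      ≤ ENNReal.ofReal (N * (ρ ^ n * volume.real (ball (0 : Eu n) 1))) := by
        apply ENNReal.ofReal_le_ofReal
        have e2 : ρ ^ n = ρ * ρ ^ (n-1) := by
          rw [← pow_succ']; congr 1; omega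
        calc _ = r / (8 * ρ) * (ρ ^ n * volume.real (ball (0 : Eu n) 1)) := by
              rw [e2]
              have : ρ ^ (n-1) = q ^ (n-1) * δ ^ (n-1) := by rw [hρ, mul_pow]
              rw [this]; field_simp
          _ ≤ _ := by
              have := ball_vol_pos n
              gcongr
    _ = ∑ k ∈ Finset.range N, volume (ball (c k) ρ) := by
        have : ∀ k ∈ Finset.range N, volume (ball (c k) ρ) =
            ENNReal.ofReal (ρ ^ n * volume.real (ball (0 : Eu n) 1)) := by
          intro k _
          rw [Measure.addHaar_ball _ _ (by positivity), ENNReal.ofReal_mul (by positivity)]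
          simp [Measure.real, ENNReal.ofReal_toReal measure_ball_lt_top.ne]
        rw [Finset.sum_congr rfl this, Finset.sum_const, Finset.card_range, nsmul_eq_mul,
          ENNReal.ofReal_mul (p := (N:ℝ)) (by positivity), ENNReal.ofReal_natCast]
    _ = volume (⋃ k ∈ Finset.range N, ball (c k) ρ) :=
        (measure_biUnion_finset hdisj' (fun _ _ => measurableSet_ball)).symm
    _ ≤ _ := measure_mono hcov

lemma coneS_inter_subset {n : ℕ} {K : Set (Eu n)} (hc : Convex ℝ K) (hK0 : K ∈ 𝓝 0)
    {P Q : Set (Eu n)} (hP : P ⊆ frontier K) (hQ : Q ⊆ frontier K) {z : Eu n}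
    (hz : z ∈ coneS P) (hz' : z ∈ coneS Q) (h0 : z ≠ 0) :
    ∃ s ∈ Icc (0:ℝ) 1, ∃ x ∈ P ∩ Q, z = s • x ∧ x = (gauge K z)⁻¹ • z := by
  obtain ⟨s, hs, x, hx, rfl⟩ := hz
  obtain ⟨s', hs', x', hx', he⟩ := hz'
  have g1 : gauge K (s • x) = s := by
    rw [gauge_smul_of_nonneg hs.1, (gauge_eq_one_iff_mem_frontier hc hK0).2 (hP hx)]; simp
  have g2 : gauge K (s • x) = s' := by
    rw [he, gauge_smul_of_nonneg hs'.1, (gauge_eq_one_iff_mem_frontier hc hK0).2 (hQ hx')]; simp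
  have hss : s = s' := g1.symm.trans g2
  subst hss
  have hs0 : s ≠ 0 := by rintro rfl; simp at h0
  have : x = x' := smul_right_injective _ hs0 he
  subst this
  refine ⟨s, hs, x, ⟨hx, hx'⟩, rfl, ?_⟩
  rw [g1, smul_smul, inv_mul_cancel₀ hs0, one_smul]

lemma haus_le_cone {n : ℕ} (hn : 2 ≤ n) {K : Set (Eu n)} (hc : Convex ℝ K) {r R : ℝ}
    (hr : 0 < r) (hR : 0 < R) (hrK : ball 0 r ⊆ K) (hKR : K ⊆ closedBall 0 R) :
    ∃ C : ℝ≥0∞, C ≠ ∞ ∧ ∀ P : Set (Eu n), IsCompact P → P ⊆ frontier K →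
      μH[(n:ℝ) - 1] P ≤ C * volume (coneS P) := by
  have hK0 : K ∈ 𝓝 0 := Filter.mem_of_superset (ball_mem_nhds _ hr) hrK
  obtain ⟨c, hcpos, hc1⟩ := tube_lower hn hc hr hR hrK hKR
  have hexp : (n:ℝ) - 1 = ((n-1 : ℕ) : ℝ) := by
    rw [Nat.cast_sub (by omega)]; simp
  have hnt : Nontrivial (Eu n) := by
    have : Nonempty (Fin n) := ⟨⟨0, by omega⟩⟩
    infer_instance
  set C : ℝ := 10 ^ (n-1) / c with hC
  have hCpos : 0 < C := by positivity
  refine ⟨ENNReal.ofReal C, ENNReal.ofReal_ne_top, fun P hP hPK => ?_⟩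
  have hfc : IsCompact (frontier K) := by
    apply Metric.isCompact_of_isClosed_isBounded isClosed_frontier
    exact (isBounded_closedBall.subset (closure_minimal hKR isClosed_closedBall)).subset frontier_subset_closure
  rcases P.eq_empty_or_nonempty with rfl | hPne
  · simp
  let δ : ℕ → ℝ := fun k => r / (k + 1)
  have hδpos : ∀ k, 0 < δ k := fun k => by positivity
  have hδr : ∀ k, δ k ≤ r := fun k => div_le_self hr.le (by simp)
  have hδ0 : Tendsto δ atTop (𝓝 0) := by
    have := (tendsto_one_div_add_atTop_nhds_zero_nat (𝕜 := ℝ)).const_mul r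
    simpa [δ, div_eq_mul_inv] using this
  have hδanti : Antitone δ := by
    intro i j hij
    show r / (j + 1) ≤ r / (i + 1)
    have : (i:ℝ) ≤ j := by exact_mod_cast hij
    gcongr
  have hu : ∀ k, ∃ u ⊆ P, (u.PairwiseDisjoint fun a => closedBall a (δ k)) ∧
      ∀ a ∈ P, ∃ b ∈ u, closedBall a (δ k) ⊆ closedBall b (5 * δ k) := fun k =>
    Vitali.exists_disjoint_subfamily_covering_enlargement_closedBall P (fun x => x)
      (fun _ => δ k) (δ k) (fun _ _ => le_rfl) 5 (by norm_num)
  choose u huP hud hucov using hu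
  have hucount : ∀ k, (u k).Countable := fun k =>
    (hud k).countable_of_nonempty_interior fun a _ =>
      ⟨a, ball_subset_interior_closedBall (mem_ball_self (hδpos k))⟩
  have : ∀ k, Countable (u k) := fun k => (hucount k).to_subtype
  let Pk : ℕ → Set (Eu n) := fun k => frontier K ∩ cthickening (δ k) P
  have hPkc : ∀ k, IsCompact (Pk k) := fun k => hfc.inter_right isClosed_cthickening
  have h1 : μH[(n:ℝ) - 1] P ≤ liminf (fun k => ∑' i : u k,
      ediam (closedBall (i : Eu n) (5 * δ k)) ^ ((n:ℝ) - 1)) atTop := by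
    apply Measure.hausdorffMeasure_le_liminf_tsum _ P (fun k => ENNReal.ofReal (10 * δ k)) _
      (fun k (i : u k) => closedBall (i : Eu n) (5 * δ k))
    · refine Eventually.of_forall fun k i => ?_
      refine Metric.ediam_le_of_forall_dist_le fun x hx y hy => ?_
      have := dist_triangle_right x y (i : Eu n)
      rw [mem_closedBall] at hx hy
      linarith
    · refine Eventually.of_forall fun k a ha => ?_
      obtain ⟨b, hb, hab⟩ := hucov k a ha
      exact mem_iUnion.2 ⟨⟨b, hb⟩, hab (mem_closedBall_self (hδpos k).le)⟩
    · have := (ENNReal.continuous_ofReal.tendsto _).comp (hδ0.const_mul 10)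
      rw [mul_zero, ENNReal.ofReal_zero] at this
      exact this
  have h2 : ∀ k, ∑' i : u k, ediam (closedBall (i : Eu n) (5 * δ k)) ^ ((n:ℝ) - 1) ≤
      ENNReal.ofReal C * volume (coneS (Pk k)) := by
    intro k
    have hmeas : ∀ i : u k, MeasurableSet (coneS (frontier K ∩ closedBall (i : Eu n) (δ k))) :=
      fun i => (coneS_compact (hfc.inter_right isClosed_closedBall)).measurableSet
    calc ∑' i : u k, ediam (closedBall (i : Eu n) (5 * δ k)) ^ ((n:ℝ) - 1)
        ≤ ∑' i : u k, ENNReal.ofReal C * volume (coneS (frontier K ∩ closedBall (i : Eu n) (δ k))) := by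
          refine ENNReal.tsum_le_tsum fun i => ?_
          have hd : ediam (closedBall (i : Eu n) (5 * δ k)) ≤ ENNReal.ofReal (10 * δ k) := by
            refine Metric.ediam_le_of_forall_dist_le fun x hx y hy => ?_
            have := dist_triangle_right x y (i : Eu n)
            rw [mem_closedBall] at hx hy
            linarith
          calc _ ≤ ENNReal.ofReal (10 * δ k) ^ (n-1) := by
                rw [hexp, ENNReal.rpow_natCast]; gcongr
            _ = ENNReal.ofReal C * ENNReal.ofReal (c * δ k ^ (n-1)) := by
                have := hδpos k
                rw [← ENNReal.ofReal_pow (by positivity), ← ENNReal.ofReal_mul hCpos.le]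
                congr 1
                rw [hC, mul_pow]; field_simp
            _ ≤ _ := by
                gcongr
                exact hc1 _ (hPK (huP k i.2)) _ (hδpos k) (hδr k)
      _ = ENNReal.ofReal C * volume (⋃ i : u k, coneS (frontier K ∩ closedBall (i : Eu n) (δ k))) := by
          rw [ENNReal.tsum_mul_left, measure_iUnion₀ _ (fun i => (hmeas i).nullMeasurableSet)]
          intro i j hij
          have hsub : coneS (frontier K ∩ closedBall (i : Eu n) (δ k)) ∩
              coneS (frontier K ∩ closedBall (j : Eu n) (δ k)) ⊆ {0} := by
            rintro z ⟨hz1, hz2⟩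
            by_contra h0
            obtain ⟨s, hs, x, hx, -⟩ := coneS_inter_subset hc hK0 inter_subset_left inter_subset_left
              hz1 hz2 h0
            have := hud k i.2 j.2 (fun h => hij (Subtype.ext h))
            exact Set.disjoint_left.1 this hx.1.2 hx.2.2
          exact measure_mono_null hsub (measure_singleton _)
      _ ≤ _ := by
          gcongr
          refine iUnion_subset fun i => coneS_mono ?_
          rintro x ⟨hx, hxi⟩
          exact ⟨hx, mem_cthickening_of_dist_le x i _ _ (huP k i.2) hxi⟩
  have h3 : Tendsto (fun k => volume (coneS (Pk k))) atTop (𝓝 (volume (coneS P))) := by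
    have e : coneS P = ⋂ k, coneS (Pk k) := by
      apply Subset.antisymm
      · refine subset_iInter fun k => coneS_mono fun x hx => ⟨hPK hx, ?_⟩
        exact self_subset_cthickening _ hx
      · intro z hz
        rw [mem_iInter] at hz
        by_cases h0 : z = 0
        · obtain ⟨x, hx⟩ := hPne
          exact ⟨0, by simp, x, hx, by simp [h0]⟩
        have hx : ∀ k, (gauge K z)⁻¹ • z ∈ Pk k := by
          intro k
          obtain ⟨s, hs, x, hx, hzx, hxz⟩ := coneS_inter_subset hc hK0 inter_subset_left inter_subset_left
            (hz k) (hz k) h0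
          rw [← hxz]; exact hx.1
        obtain ⟨s, hs, x, hx', hzx, hxz⟩ := coneS_inter_subset hc hK0 inter_subset_left inter_subset_left
            (hz 0) (hz 0) h0
        refine ⟨s, hs, x, ?_, hzx⟩
        rw [hxz]
        have hcl : (gauge K z)⁻¹ • z ∈ closure P := by
          rw [Metric.mem_closure_iff_infEDist_zero]
          apply le_antisymm _ zero_le
          have ht : Tendsto (fun k => ENNReal.ofReal (δ k)) atTop (𝓝 0) := by
            have := (ENNReal.continuous_ofReal.tendsto _).comp hδ0
            rwa [ENNReal.ofReal_zero] at this
          exact ge_of_tendsto' ht fun k => mem_cthickening_iff.1 (hx k).2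
        rwa [hP.isClosed.closure_eq] at hcl
    rw [e]
    apply tendsto_measure_iInter_atTop
    · exact fun k => (coneS_compact (hPkc k)).measurableSet.nullMeasurableSet
    · intro i j hij
      exact coneS_mono (inter_subset_inter_right _ (cthickening_mono (hδanti hij) _))
    · exact ⟨0, (coneS_compact (hPkc 0)).measure_lt_top.ne⟩
  have h4 := ENNReal.Tendsto.const_mul h3 (Or.inr (ENNReal.ofReal_ne_top (r := C)))
  calc _ ≤ _ := h1
    _ ≤ liminf (fun k => ENNReal.ofReal C * volume (coneS (Pk k))) atTop :=
        liminf_le_liminf (Eventually.of_forall h2)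
    _ = _ := h4.liminf_eq


lemma le_suppFn {n : ℕ} {K : Set (Eu n)} (hK : IsCompact K) (u : Eu n) {y : Eu n} (hy : y ∈ K) :
    ⟪u, y⟫ ≤ suppFn K u := by
  apply le_csSup
  · exact (hK.image (by fun_prop)).bddAbove
  · exact ⟨y, hy, rfl⟩

lemma suppFn_le {n : ℕ} {K : Set (Eu n)} (hK : K.Nonempty) (u : Eu n) {c : ℝ}
    (h : ∀ y ∈ K, ⟪u, y⟫ ≤ c) : suppFn K u ≤ c := by
  apply csSup_le (hK.image _)
  rintro _ ⟨y, hy, rfl⟩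
  exact h y hy

lemma suppFn_lip {n : ℕ} {K : Set (Eu n)} (hK : IsCompact K) (hne : K.Nonempty) {R : ℝ}
    (hR : K ⊆ closedBall 0 R) (u v : Eu n) : suppFn K u ≤ suppFn K v + R * ‖u - v‖ := by
  apply suppFn_le hne
  intro y hy
  have h1 : ⟪u, y⟫ = ⟪v, y⟫ + ⟪u - v, y⟫ := by rw [inner_sub_left]; ring
  have h2 := real_inner_le_norm (u - v) y
  have h3 : ‖y‖ ≤ R := by simpa using hR hy
  have h4 := le_suppFn hK v hy
  have : ‖u - v‖ * ‖y‖ ≤ ‖u - v‖ * R := by gcongr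
  linarith

lemma suppFn_cont {n : ℕ} {K : Set (Eu n)} (hK : IsCompact K) (hne : K.Nonempty) :
    Continuous (suppFn K) := by
  obtain ⟨R, hR⟩ := hK.isBounded.subset_closedBall 0
  have hR' : K ⊆ closedBall 0 (max R 0) := hR.trans (closedBall_subset_closedBall (le_max_left _ _))
  have : LipschitzWith (Real.toNNReal (max R 0)) (suppFn K) := by
    apply LipschitzWith.of_le_add_mul
    intro x y
    rw [Real.coe_toNNReal _ (le_max_right _ _), dist_eq_norm]
    exact suppFn_lip hK hne hR' x y
  exact this.continuous

lemma face_subset_frontier {n : ℕ} {K : Set (Eu n)} (hK : IsCompact K) {u : Eu n} (hu : u ≠ 0) :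
    face K u ⊆ frontier K := by
  rintro z ⟨hz, hzu⟩
  refine ⟨subset_closure hz, fun hint => ?_⟩
  rw [mem_interior_iff_mem_nhds, Metric.mem_nhds_iff] at hint
  obtain ⟨ε, hε, hb⟩ := hint
  have hun : 0 < ‖u‖ := norm_pos_iff.2 hu
  have hmem : z + (ε / (2 * ‖u‖)) • u ∈ K := by
    apply hb
    rw [mem_ball, dist_eq_norm, add_sub_cancel_left, norm_smul, Real.norm_of_nonneg (by positivity)]
    field_simp; linarith
  have h1 := le_suppFn hK u hmem
  rw [inner_add_right, inner_smul_right, real_inner_comm, hzu, real_inner_self_eq_norm_sq] at h1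
  have : 0 < ε / (2 * ‖u‖) * ‖u‖ ^ 2 := by positivity
  linarith

lemma haus_frontier_lt_top {n : ℕ} (hn : 2 ≤ n) {K : Set (Eu n)} (hK : IsCompact K)
    (hc : Convex ℝ K) (hi : (interior K).Nonempty) : μH[(n:ℝ) - 1] (frontier K) < ∞ := by
  obtain ⟨x, hx⟩ := hi
  let e : Eu n ≃ᵢ Eu n := IsometryEquiv.addRight (-x)
  set K' := e '' K with hK'
  have hK'c : IsCompact K' := hK.image e.continuous
  have hK'conv : Convex ℝ K' := by
    rintro _ ⟨y, hy, rfl⟩ _ ⟨z, hz, rfl⟩ s t hs ht hst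
    refine ⟨s • y + t • z, hc hy hz hs ht hst, ?_⟩
    have e1 : ∀ z, e z = z + (-x) := fun z => rfl
    rw [e1, e1, e1]
    have : x = s • x + t • x := by rw [← add_smul, hst, one_smul]
    rw [smul_add, smul_add, smul_neg, smul_neg]
    conv_lhs => rw [this]
    abel
  have h0 : (0 : Eu n) ∈ interior K' := by
    have := e.toHomeomorph.image_interior K
    have h2 : e x = 0 := by simp [e]
    rw [← h2]
    have h3 : interior K' = e '' interior K := this.symm
    rw [h3]; exact ⟨x, hx, rfl⟩
  rw [mem_interior_iff_mem_nhds, Metric.mem_nhds_iff] at h0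
  obtain ⟨r, hr, hrK⟩ := h0
  obtain ⟨R, hR, hKR⟩ := hK'c.isBounded.subset_closedBall_lt 0 0
  obtain ⟨C, hC, hb⟩ := haus_le_cone hn hK'conv hr hR hrK hKR
  have hfc : IsCompact (frontier K') :=
    hK'c.of_isClosed_subset isClosed_frontier hK'c.isClosed.frontier_subset
  have h4 := hb _ hfc Subset.rfl
  have h5 : frontier K' = e '' frontier K := (e.toHomeomorph.image_frontier K).symm
  rw [h5, e.hausdorffMeasure_image] at h4
  refine h4.trans_lt ?_
  rw [← h5]
  exact ENNReal.mul_lt_top hC.lt_top (coneS_compact hfc).measure_lt_top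

lemma exists_normal {n : ℕ} {K : Set (Eu n)} (hK : IsCompact K)
    (hc : Convex ℝ K) (hi : (interior K).Nonempty) (h0 : (0 : Eu n) ∉ interior K) :
    ∃ u : Eu n, ‖u‖ = 1 ∧ ∀ y ∈ K, ⟪u, y⟫ ≤ 0 := by
  obtain ⟨f, hf⟩ := geometric_hahn_banach_open_point hc.interior isOpen_interior h0
  set v := (InnerProductSpace.toDual ℝ (Eu n)).symm f with hv
  have hvf : ∀ y, ⟪v, y⟫ = f y := fun y => InnerProductSpace.toDual_symm_apply
  have hle : ∀ y ∈ K, ⟪v, y⟫ ≤ 0 := by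
    have hcl : K ⊆ closure (interior K) := by
      rw [hc.closure_interior_eq_closure_of_nonempty_interior hi]; exact subset_closure
    intro y hy
    have : closure (interior K) ⊆ {y | ⟪v, y⟫ ≤ 0} := by
      apply closure_minimal
      · intro a ha
        have := hf a ha
        rw [map_zero] at this
        show ⟪v, a⟫ ≤ 0
        rw [hvf]; exact this.le
      · exact isClosed_le (by fun_prop) (by fun_prop)
    exact this (hcl hy)
  have hv0 : v ≠ 0 := by
    intro h
    obtain ⟨a, ha⟩ := hi
    have := hf a ha
    rw [map_zero, ← hvf, h, inner_zero_left] at this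
    exact lt_irrefl _ this
  refine ⟨‖v‖⁻¹ • v, ?_, ?_⟩
  · rw [norm_smul, norm_inv, norm_norm, inv_mul_cancel₀ (norm_ne_zero_iff.2 hv0)]
  · intro y hy
    rw [real_inner_smul_left]
    exact mul_nonpos_of_nonneg_of_nonpos (by positivity) (hle y hy)

lemma zero_mem_interior {n : ℕ} (hn : 2 ≤ n) {p : ℝ} (hp : p ≤ 2 - (n : ℝ)) {τ1 τ2 : ℝ}
    (hτ1 : 0 < τ1) {f : Eu n → ℝ}
    (hf : ∀ u ∈ unitSphere n, τ1 < f u ∧ f u < τ2)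
    {K : Set (Eu n)} (hK : IsConvexBody0 K)
    (hsol : IsLpSolution p f K) : (0 : Eu n) ∈ interior K := by
  obtain ⟨hKc, hconv, hi, h0K⟩ := hK
  by_contra h0
  obtain ⟨u0, hu0, hu0K⟩ := exists_normal hKc hconv hi h0
  have hne : K.Nonempty := ⟨0, h0K⟩
  have hnt : Nontrivial (Eu n) := by
    have : Nonempty (Fin n) := ⟨⟨0, by omega⟩⟩
    infer_instance
  obtain ⟨R, hR, hKR⟩ := hKc.isBounded.subset_closedBall_lt 0 0
  have hcont := suppFn_cont hKc hne
  have hpos : ∀ u, 0 ≤ suppFn K u := fun u => by simpa using le_suppFn hKc u h0K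
  have hsu0 : suppFn K u0 = 0 := le_antisymm (suppFn_le hne _ hu0K) (hpos _)
  set ω : Set (Eu n) := {u ∈ unitSphere n | 0 < suppFn K u} with hω
  have hSm : MeasurableSet (unitSphere n) := isClosed_sphere.measurableSet
  have hωm : MeasurableSet ω := hSm.inter (isOpen_lt continuous_const hcont).measurableSet
  -- sphere comparison
  have hfr : frontier (closedBall (0 : Eu n) 1) = unitSphere n := frontier_closedBall _ one_ne_zero
  obtain ⟨c, hc, htube⟩ := tube_lower hn (convex_closedBall (0 : Eu n) 1) one_pos one_pos
    ball_subset_closedBall Subset.rfl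
  obtain ⟨C, hC0, hCtop, hcone⟩ := cone_le_haus hn (n := n) one_pos
  obtain ⟨D, hDtop, hhaus⟩ := haus_le_cone hn (convex_closedBall (0 : Eu n) 1) one_pos one_pos
    ball_subset_closedBall Subset.rfl
  rw [hfr] at htube hhaus
  have hScomp : IsCompact (unitSphere n) := isCompact_sphere _ _
  have hSfin : μH[(n:ℝ) - 1] (unitSphere n) < ∞ :=
    (hhaus _ hScomp Subset.rfl).trans_lt
      (ENNReal.mul_lt_top hDtop.lt_top (coneS_compact hScomp).measure_lt_top)
  set F : Eu n → ℝ≥0∞ := fun u => ENNReal.ofReal ((n : ℝ) * f u * suppFn K u ^ (p - 1)) with hF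
  have hfin : ∫⁻ u in ω, F u ∂μH[(n : ℝ) - 1] ≠ ∞ := by
    rw [← hsol.2 ω hωm Subset.rfl]
    refine ne_top_of_le_ne_top (haus_frontier_lt_top hn hKc hconv hi).ne (measure_mono ?_)
    refine iUnion₂_subset fun u hu => face_subset_frontier hKc ?_
    rintro rfl
    have := hu.1
    simp [unitSphere] at this
  let ρ : ℕ → ℝ := fun k => 1 / ((k:ℝ) + 1) / (R + 1)
  have hρpos : ∀ k, 0 < ρ k := fun k => by positivity
  have hρ0 : Tendsto ρ atTop (𝓝 0) := by
    have := (tendsto_one_div_add_atTop_nhds_zero_nat (𝕜 := ℝ)).div_const (R + 1)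
    simpa [ρ] using this
  have hkle : ∀ k : ℕ, 1 / ((k:ℝ) + 1) ≤ 1 := fun k => by
    rw [div_le_one (by positivity)]; linarith [(Nat.cast_nonneg k : (0:ℝ) ≤ k)]
  have hρ1 : ∀ k, ρ k ≤ 1 := fun k => by
    show 1 / ((k:ℝ) + 1) / (R + 1) ≤ 1
    rw [div_le_one (by positivity)]; linarith [hkle k]
  have hρR : ∀ k, R * ρ k ≤ 1 := fun k => by
    show R * (1 / ((k:ℝ) + 1) / (R + 1)) ≤ 1
    rw [mul_div_assoc', div_le_one (by positivity)]; nlinarith [hkle k]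
  have hρanti : Antitone ρ := by
    intro i j hij
    show 1 / ((j:ℝ) + 1) / (R + 1) ≤ 1 / ((i:ℝ) + 1) / (R + 1)
    have : (i:ℝ) ≤ j := by exact_mod_cast hij
    gcongr
  have hmeas0 : Tendsto ((μH[(n:ℝ) - 1].restrict ω) ∘ (fun k => closedBall u0 (ρ k))) atTop (𝓝 0) := by
    have h1 : Tendsto (fun k => (μH[(n:ℝ) - 1].restrict ω) (closedBall u0 (ρ k))) atTop
        (𝓝 ((μH[(n:ℝ) - 1].restrict ω) (⋂ k, closedBall u0 (ρ k)))) := by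
      apply tendsto_measure_iInter_atTop
      · exact fun k => measurableSet_closedBall.nullMeasurableSet
      · exact fun i j hij => closedBall_subset_closedBall (hρanti hij)
      · refine ⟨0, ne_top_of_le_ne_top hSfin.ne ?_⟩
        rw [Measure.restrict_apply measurableSet_closedBall]
        exact measure_mono (inter_subset_right.trans (sep_subset _ _))
    have h2 : (μH[(n:ℝ) - 1].restrict ω) (⋂ k, closedBall u0 (ρ k)) = 0 := by
      rw [Measure.restrict_apply (MeasurableSet.iInter fun k => measurableSet_closedBall)]
      have : (⋂ k, closedBall u0 (ρ k)) ∩ ω = ∅ := by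
        ext u
        simp only [mem_inter_iff, mem_iInter, mem_closedBall, mem_empty_iff_false, iff_false]
        rintro ⟨hu, hu'⟩
        have : dist u u0 ≤ 0 := ge_of_tendsto' hρ0 hu
        have : u = u0 := dist_le_zero.1 this
        have h3 := hu'.2
        rw [this, hsu0] at h3
        exact lt_irrefl _ h3
      rw [this]; simp
    rw [h2] at h1
    exact h1
  have hto := tendsto_setLIntegral_zero hfin hmeas0
  set A : ℝ := n * τ1 * c * (R ^ (n-1))⁻¹ with hA
  have hnpos : (0:ℝ) < n := by positivity
  have hApos : 0 < A := by positivity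
  have hlow : ∀ k, ENNReal.ofReal A * C⁻¹ ≤
      ∫⁻ u in closedBall u0 (ρ k), F u ∂(μH[(n : ℝ) - 1].restrict ω) := by
    intro k
    have hρk := hρpos k
    rw [Measure.restrict_restrict measurableSet_closedBall]
    have hm : MeasurableSet (closedBall u0 (ρ k) ∩ ω) := measurableSet_closedBall.inter hωm
    have hlb : ∀ u ∈ closedBall u0 (ρ k) ∩ ω,
        ENNReal.ofReal (n * τ1 * ((R * ρ k) ^ (n-1))⁻¹) ≤ F u := by
      rintro u ⟨hu1, hu2⟩
      apply ENNReal.ofReal_le_ofReal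
      have hb : suppFn K u ≤ R * ρ k := by
        have := suppFn_lip hKc hne hKR u u0
        rw [hsu0, zero_add, ← dist_eq_norm] at this
        rw [mem_closedBall] at hu1
        nlinarith
      have h3 : ((R * ρ k) ^ (n-1))⁻¹ ≤ suppFn K u ^ (p - 1) := by
        have e : ((R * ρ k) ^ (n-1))⁻¹ = (R * ρ k) ^ (1 - (n:ℝ)) := by
          rw [← Real.rpow_natCast, ← Real.rpow_neg (by positivity), Nat.cast_sub (by omega)]
          congr 1; push_cast; ring
        rw [e]
        calc (R * ρ k) ^ (1 - (n:ℝ)) ≤ (R * ρ k) ^ (p - 1) :=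
              Real.rpow_le_rpow_of_exponent_ge (by positivity) (hρR k) (by linarith)
          _ ≤ _ := by
              apply Real.rpow_le_rpow_of_nonpos hu2.2 hb
              have : (2:ℝ) ≤ n := by exact_mod_cast hn
              linarith
      have h4 := (hf u hu2.1).1.le
      have : 0 ≤ ((R * ρ k) ^ (n-1))⁻¹ := by positivity
      exact mul_le_mul (by gcongr) h3 this (mul_nonneg hnpos.le (hτ1.le.trans h4))
    have hHm : ENNReal.ofReal (c * ρ k ^ (n-1)) ≤ C * μH[(n:ℝ) - 1] (closedBall u0 (ρ k) ∩ ω) := by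
      have h5 : μH[(n:ℝ) - 1] (unitSphere n ∩ closedBall u0 (ρ k)) ≤
          μH[(n:ℝ) - 1] (closedBall u0 (ρ k) ∩ ω) := by
        have hsub : unitSphere n ∩ closedBall u0 (ρ k) ⊆
            (closedBall u0 (ρ k) ∩ ω) ∪ {u ∈ unitSphere n | suppFn K u = 0} := by
          rintro u ⟨h1, h2⟩
          rcases (hpos u).eq_or_lt with h | h
          · exact Or.inr ⟨h1, h.symm⟩
          · exact Or.inl ⟨h2, h1, h⟩
        refine (measure_mono hsub).trans ((measure_union_le _ _).trans ?_)
        rw [hsol.1, add_zero]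
      refine (htube u0 (by simp [unitSphere, hu0]) (ρ k) hρk (hρ1 k)).trans
        ((hcone _ ?_).trans (by gcongr))
      exact inter_subset_left.trans sphere_subset_closedBall
    calc ENNReal.ofReal A * C⁻¹
        = ENNReal.ofReal (n * τ1 * ((R * ρ k) ^ (n-1))⁻¹) * (ENNReal.ofReal (c * ρ k ^ (n-1)) * C⁻¹) := by
          rw [← mul_assoc, ← ENNReal.ofReal_mul (by positivity)]
          congr 2
          rw [hA, mul_pow]; field_simp
      _ ≤ ENNReal.ofReal (n * τ1 * ((R * ρ k) ^ (n-1))⁻¹) *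
            μH[(n:ℝ) - 1] (closedBall u0 (ρ k) ∩ ω) := by
          gcongr
          rw [← div_eq_mul_inv]
          exact ENNReal.div_le_of_le_mul' hHm
      _ = ∫⁻ u in closedBall u0 (ρ k) ∩ ω, ENNReal.ofReal (n * τ1 * ((R * ρ k) ^ (n-1))⁻¹)
            ∂μH[(n : ℝ) - 1] := by rw [setLIntegral_const]
      _ ≤ _ := setLIntegral_mono' hm hlb
  have := ge_of_tendsto' hto hlow
  have hz : ENNReal.ofReal A * C⁻¹ = 0 := le_antisymm this zero_le
  rcases mul_eq_zero.1 hz with h | h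
  · rw [ENNReal.ofReal_eq_zero] at h; linarith
  · exact hCtop (ENNReal.inv_eq_zero.1 h)


structure DualPair {n : ℕ} (K L : Set (Eu n)) : Prop where
  cK : IsCompact K
  cL : IsCompact L
  vK : Convex ℝ K
  vL : Convex ℝ L
  iK : (0 : Eu n) ∈ interior K
  iL : (0 : Eu n) ∈ interior L
  hL : L = {y | ∀ x ∈ K, ⟪x, y⟫ ≤ 1}
  hK : K = {x | ∀ y ∈ L, ⟪y, x⟫ ≤ 1}

lemma DualPair.symm {n : ℕ} {K L : Set (Eu n)} (h : DualPair K L) : DualPair L K :=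
  ⟨h.cL, h.cK, h.vL, h.vK, h.iL, h.iK, h.hK, h.hL⟩

lemma DualPair.le {n : ℕ} {K L : Set (Eu n)} (h : DualPair K L) {x y : Eu n} (hx : x ∈ K)
    (hy : y ∈ L) : ⟪x, y⟫ ≤ 1 := by
  rw [h.hL] at hy; exact hy x hx

lemma ball_of_int {n : ℕ} {K : Set (Eu n)} (h : (0 : Eu n) ∈ interior K) :
    ∃ r > 0, ball (0 : Eu n) r ⊆ K := by
  rwa [mem_interior_iff_mem_nhds, Metric.mem_nhds_iff] at h

lemma dualPair_polar {n : ℕ} {K : Set (Eu n)} (cK : IsCompact K) (vK : Convex ℝ K)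
    (iK : (0 : Eu n) ∈ interior K) : DualPair K {y | ∀ x ∈ K, ⟪x, y⟫ ≤ 1} := by
  obtain ⟨r, hr, hrK⟩ := ball_of_int iK
  obtain ⟨R, hR, hKR⟩ := cK.isBounded.subset_closedBall_lt 0 0
  set L : Set (Eu n) := {y | ∀ x ∈ K, ⟪x, y⟫ ≤ 1} with hLdef
  have hLclosed : IsClosed L := by
    have : L = ⋂ x ∈ K, {y | ⟪x, y⟫ ≤ 1} := by ext; simp [hLdef]
    rw [this]
    exact isClosed_biInter fun x _ => isClosed_le (by fun_prop) continuous_const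
  have hLb : L ⊆ closedBall 0 (2 / r) := by
    intro y hy
    rw [mem_closedBall_zero_iff]
    by_cases h0 : y = 0
    · rw [h0, norm_zero]; positivity
    have hn : 0 < ‖y‖ := norm_pos_iff.2 h0
    have hm : (r / 2 / ‖y‖) • y ∈ K := by
      apply hrK
      rw [mem_ball_zero_iff, norm_smul, Real.norm_of_nonneg (by positivity)]
      field_simp; linarith
    have := hy _ hm
    rw [inner_smul_left, real_inner_self_eq_norm_sq] at this
    simp only [conj_trivial] at this
    field_simp at this
    rw [le_div_iff₀ hr]; linarith
  refine ⟨cK, (isCompact_closedBall _ _).of_isClosed_subset hLclosed hLb, vK, ?_, iK, ?_, rfl, ?_⟩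
  · intro y hy z hz s t hs ht hst x hx
    rw [inner_add_right, inner_smul_right, inner_smul_right]
    nlinarith [hy x hx, hz x hx]
  · rw [mem_interior_iff_mem_nhds, Metric.mem_nhds_iff]
    refine ⟨1 / R, by positivity, fun y hy x hx => ?_⟩
    rw [mem_ball_zero_iff, lt_div_iff₀ hR] at hy
    have hxR := hKR hx
    rw [mem_closedBall_zero_iff] at hxR
    have := real_inner_le_norm x y
    nlinarith [norm_nonneg y]
  · apply Subset.antisymm
    · intro x hx y hy
      rw [real_inner_comm]; exact hy x hx
    · intro x hx
      by_contra hxK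
      obtain ⟨f, u, h1, h2⟩ := geometric_hahn_banach_closed_point vK cK.isClosed hxK
      set v := (InnerProductSpace.toDual ℝ (Eu n)).symm f with hv
      have hvf : ∀ y, ⟪v, y⟫ = f y := fun y => InnerProductSpace.toDual_symm_apply
      have hu : 0 < u := by simpa using h1 0 (interior_subset iK)
      have hm : u⁻¹ • v ∈ L := by
        intro z hz
        rw [inner_smul_right, real_inner_comm, hvf]
        rw [inv_mul_le_iff₀ hu, mul_one]; exact (h1 z hz).le
      have := hx _ hm
      rw [inner_smul_left, hvf] at this
      simp only [conj_trivial] at this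
      rw [inv_mul_le_iff₀ hu, mul_one] at this
      linarith

lemma DualPair.frontier_iff {n : ℕ} {K L : Set (Eu n)} (h : DualPair K L) (x : Eu n) :
    x ∈ frontier K ↔ x ∈ K ∧ ∃ y ∈ L, ⟪x, y⟫ = 1 := by
  constructor
  · intro hx
    have hxK : x ∈ K := h.cK.isClosed.frontier_subset hx
    refine ⟨hxK, ?_⟩
    obtain ⟨y, hy, hmax⟩ := h.cL.exists_isMaxOn ⟨0, interior_subset h.iL⟩
      (f := fun y => ⟪x, y⟫) (by fun_prop)
    refine ⟨y, hy, le_antisymm (h.le hxK hy) ?_⟩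
    by_contra hlt
    push Not at hlt
    apply hx.2
    obtain ⟨R, hR, hLR⟩ := h.cL.isBounded.subset_closedBall_lt 0 0
    rw [mem_interior_iff_mem_nhds, Metric.mem_nhds_iff]
    refine ⟨(1 - ⟪x, y⟫) / R, div_pos (by linarith) hR, fun z hz => ?_⟩
    rw [h.hK]
    intro w hw
    rw [mem_ball, dist_eq_norm, lt_div_iff₀ hR] at hz
    have h1 : ⟪x, w⟫ ≤ ⟪x, y⟫ := hmax hw
    have h2 := real_inner_le_norm w (z - x)
    have h3 := hLR hw
    rw [mem_closedBall_zero_iff] at h3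
    rw [inner_sub_right, real_inner_comm x w] at h2
    nlinarith [norm_nonneg (z - x)]
  · rintro ⟨hx, y, hy, hxy⟩
    refine ⟨subset_closure hx, fun hint => ?_⟩
    rw [mem_interior_iff_mem_nhds] at hint
    have ht : Tendsto (fun t : ℝ => t • x) (𝓝[>] 1) (𝓝 x) := by
      have : Tendsto (fun t : ℝ => t • x) (𝓝 1) (𝓝 ((1:ℝ) • x)) :=
        (continuous_id.smul continuous_const).tendsto 1
      rw [one_smul] at this
      exact this.mono_left nhdsWithin_le_nhds
    obtain ⟨t, ht1, ht2⟩ := ((ht.eventually hint).and self_mem_nhdsWithin).exists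
    have := h.le ht1 hy
    rw [inner_smul_left, hxy] at this
    simp at this
    exact absurd ht2 (not_lt.2 this)

/-- dual image -/
def dstar {n : ℕ} (L P : Set (Eu n)) : Set (Eu n) := {y ∈ L | ∃ x ∈ P, ⟪x, y⟫ = 1}

lemma dstar_compact {n : ℕ} {L P : Set (Eu n)} (hL : IsCompact L) (hP : IsCompact P) :
    IsCompact (dstar L P) := by
  have h1 : IsCompact ((P ×ˢ L) ∩ {z : Eu n × Eu n | ⟪z.1, z.2⟫ = 1}) :=
    (hP.prod hL).inter_right (isClosed_eq (by fun_prop) continuous_const)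
  convert h1.image continuous_snd using 1
  ext y
  constructor
  · rintro ⟨hy, x, hx, hxy⟩; exact ⟨(x, y), ⟨⟨hx, hy⟩, hxy⟩, rfl⟩
  · rintro ⟨⟨x, y'⟩, ⟨⟨hx, hy⟩, hxy⟩, rfl⟩; exact ⟨hy, x, hx, hxy⟩

lemma dstar_subset {n : ℕ} {K L P : Set (Eu n)} (h : DualPair K L) (hP : P ⊆ K) :
    dstar L P ⊆ frontier L := by
  rintro y ⟨hy, x, hx, hxy⟩
  exact (h.symm.frontier_iff y).2 ⟨hy, x, hP hx, by rw [real_inner_comm]; exact hxy⟩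

open scoped Pointwise in
lemma cone_scale {n : ℕ} {P Q : Set (Eu n)} {M : ℝ} (hM : 0 < M)
    (h : ∀ x ∈ P, ∃ y ∈ Q, ∃ t, 0 ≤ t ∧ t ≤ M ∧ x = t • y) :
    volume (coneS P) ≤ ENNReal.ofReal (M ^ n) * volume (coneS Q) := by
  have h1 : coneS P ⊆ M • coneS Q := by
    rintro _ ⟨s, hs, x, hx, rfl⟩
    obtain ⟨y, hy, t, ht0, htM, rfl⟩ := h x hx
    refine ⟨(s * t / M) • y, ⟨s * t / M, ⟨by have := hs.1; positivity, ?_⟩, y, hy, rfl⟩, ?_⟩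
    · rw [div_le_one hM]; nlinarith [hs.1, hs.2]
    · simp only [smul_smul]; congr 1; field_simp
  calc volume (coneS P) ≤ volume (M • coneS Q) := measure_mono h1
    _ = _ := by
      rw [Measure.addHaar_smul, finrank_euclideanSpace, Fintype.card_fin, abs_of_nonneg (by positivity)]

def Bnd {n : ℕ} (C : ℝ≥0∞) (K L : Set (Eu n)) : Prop :=
  ∀ P, IsCompact P → P ⊆ frontier K → volume (coneS P) ≤ C * volume (coneS (dstar L P))

lemma frontier_bounds {n : ℕ} {K L : Set (Eu n)} (h : DualPair K L) :
    ∃ r R : ℝ, 0 < r ∧ 0 < R ∧ ball 0 r ⊆ K ∧ K ⊆ closedBall 0 R ∧ ∀ x ∈ frontier K, r ≤ ‖x‖ ∧ ‖x‖ ≤ R := by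
  obtain ⟨r, hr, hrK⟩ := ball_of_int h.iK
  obtain ⟨R, hR, hKR⟩ := h.cK.isBounded.subset_closedBall_lt 0 0
  refine ⟨r, R, hr, hR, hrK, hKR, fun x hx => ⟨?_, ?_⟩⟩
  · by_contra hlt
    push Not at hlt
    apply hx.2
    exact mem_interior.2 ⟨_, hrK, isOpen_ball, by rwa [mem_ball_zero_iff]⟩
  · simpa using hKR (h.cK.isClosed.frontier_subset hx)

/-- the normal image comparison -/
lemma bnd_of_sol {n : ℕ} (hn : 2 ≤ n) {p : ℝ} (hp : p ≤ 2 - (n : ℝ)) {τ1 τ2 : ℝ}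
    (hτ1 : 0 < τ1) {f : Eu n → ℝ}
    (hf : ∀ u ∈ unitSphere n, τ1 < f u ∧ f u < τ2)
    {K L : Set (Eu n)} (h : DualPair K L)
    (hsol : IsLpSolution p f K) : ∃ C, C ≠ ∞ ∧ Bnd C K L ∧ Bnd C L K := by
  obtain ⟨r, R, hr, hR, hrK, hKR, -⟩ := frontier_bounds h
  obtain ⟨r', R', hr', hR', -, -, hLb⟩ := frontier_bounds h.symm
  have hn0 : (0:ℝ) < n := by positivity
  have hn2 : (2:ℝ) ≤ n := by exact_mod_cast hn
  have hne : K.Nonempty := ⟨0, interior_subset h.iK⟩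
  obtain ⟨C1, hC10, hC1, hcone⟩ := cone_le_haus hn (R := max R 1) (by positivity)
  obtain ⟨C2, hC2, hhaus⟩ := haus_le_cone hn h.vK hr hR hrK hKR
  obtain ⟨C3, hC3, hhaus1⟩ := haus_le_cone hn (convex_closedBall (0 : Eu n) 1) one_pos one_pos
    ball_subset_closedBall Subset.rfl
  have hfr : frontier (closedBall (0 : Eu n) 1) = unitSphere n := by
    rw [frontier_closedBall _ one_ne_zero]; rfl
  rw [hfr] at hhaus1
  set N : Eu n → Eu n := fun y => ‖y‖⁻¹ • y with hN
  have hNs : ∀ y ∈ frontier L, N y ∈ unitSphere n := by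
    intro y hy
    have := (hLb y hy).1
    have h0 : ‖y‖ ≠ 0 := by linarith
    simp [hN, unitSphere, norm_smul, inv_mul_cancel₀ h0]
  have hh : ∀ u ∈ unitSphere n, r / 2 ≤ suppFn K u ∧ suppFn K u ≤ R := by
    intro u hu
    have hu1 : ‖u‖ = 1 := by simpa [unitSphere] using hu
    constructor
    · have hm : (r / 2) • u ∈ K := by
        apply hrK
        rw [mem_ball_zero_iff, norm_smul, hu1, Real.norm_of_nonneg (by positivity)]; linarith
      have := le_suppFn h.cK u hm
      rwa [inner_smul_right, real_inner_self_eq_norm_sq, hu1, one_pow, mul_one] at this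
    · apply suppFn_le hne
      intro y hy
      have h1 := real_inner_le_norm u y
      have h2 := hKR hy
      rw [mem_closedBall_zero_iff] at h2
      rw [hu1] at h1; linarith
  have hsup : ∀ y ∈ frontier L, suppFn K (N y) = ‖y‖⁻¹ := by
    intro y hy
    have hy0 : 0 < ‖y‖ := lt_of_lt_of_le hr' (hLb y hy).1
    obtain ⟨hyL, x, hx, hxy⟩ := (h.symm.frontier_iff y).1 hy
    apply le_antisymm
    · apply suppFn_le hne
      intro z hz
      have := h.le hz hyL
      rw [real_inner_comm] at this
      simp only [hN, inner_smul_left, conj_trivial]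
      calc ‖y‖⁻¹ * ⟪y, z⟫ ≤ ‖y‖⁻¹ * 1 := by gcongr
        _ = _ := mul_one _
    · have := le_suppFn h.cK (N y) hx
      simpa only [hN, inner_smul_left, conj_trivial, hxy, mul_one] using this
  have hface : ∀ y ∈ frontier L, ∀ x, x ∈ face K (N y) ↔ x ∈ K ∧ ⟪y, x⟫ = 1 := by
    intro y hy x
    have hy0 : 0 < ‖y‖ := lt_of_lt_of_le hr' (hLb y hy).1
    simp only [face, mem_ofPred_eq, hsup y hy]
    simp only [hN, inner_smul_right]
    rw [real_inner_comm]
    constructor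
    · rintro ⟨h1, h2⟩; refine ⟨h1, ?_⟩; field_simp at h2; exact h2
    · rintro ⟨h1, h2⟩; exact ⟨h1, by rw [h2, mul_one]⟩
  have hsurf : ∀ Q, Q ⊆ frontier L → surfMeas K (N '' Q) = μH[(n:ℝ) - 1] (dstar K Q) := by
    intro Q hQ
    unfold surfMeas
    congr 1
    ext x
    simp only [mem_iUnion, exists_prop, exists_mem_image, dstar, mem_ofPred_eq]
    constructor
    · rintro ⟨y, hy, hxy⟩
      rw [hface y (hQ hy)] at hxy
      exact ⟨hxy.1, y, hy, hxy.2⟩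
    · rintro ⟨hx, y, hy, hxy⟩
      exact ⟨y, hy, (hface y (hQ hy) x).2 ⟨hx, hxy⟩⟩
  have hNc : ∀ Q, IsCompact Q → Q ⊆ frontier L → IsCompact (N '' Q) := by
    intro Q hQ hQL
    apply hQ.image_of_continuousOn
    refine ContinuousOn.smul (f := fun y : Eu n => ‖y‖⁻¹) (g := fun y => y) ?_ continuousOn_id
    refine ContinuousOn.inv₀ continuous_norm.continuousOn ?_
    intro y hy
    have := (hLb y (hQL hy)).1
    linarith
  have hint : ∀ Q, IsCompact Q → Q ⊆ frontier L → μH[(n:ℝ) - 1] (dstar K Q) =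
      ∫⁻ u in N '' Q, ENNReal.ofReal ((n : ℝ) * f u * suppFn K u ^ (p - 1)) ∂μH[(n : ℝ) - 1] := by
    intro Q hQ hQL
    rw [← hsurf Q hQL]
    apply hsol.2 _ (hNc Q hQ hQL).measurableSet
    rintro _ ⟨y, hy, rfl⟩
    refine ⟨hNs y (hQL hy), ?_⟩
    have := (hh _ (hNs y (hQL hy))).1
    linarith
  set c1 : ℝ := n * τ1 * R ^ (p - 1) with hc1
  set c2 : ℝ := n * τ2 * (r/2) ^ (p - 1) with hc2
  have hc1p : 0 < c1 := by positivity
  have hpt : ∀ u ∈ unitSphere n, c1 ≤ (n : ℝ) * f u * suppFn K u ^ (p - 1) ∧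
      (n : ℝ) * f u * suppFn K u ^ (p - 1) ≤ c2 := by
    intro u hu
    obtain ⟨a1, a2⟩ := hh u hu
    obtain ⟨b1, b2⟩ := hf u hu
    have hs : 0 < suppFn K u := by linarith
    have hfu : 0 < f u := by linarith
    have e1 : R ^ (p-1) ≤ suppFn K u ^ (p - 1) :=
      Real.rpow_le_rpow_of_nonpos hs a2 (by linarith)
    have e2 : suppFn K u ^ (p - 1) ≤ (r/2) ^ (p-1) :=
      Real.rpow_le_rpow_of_nonpos (by positivity) a1 (by linarith)
    have e3 : 0 ≤ R ^ (p-1) := by positivity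
    have e4 : 0 ≤ suppFn K u ^ (p-1) := by positivity
    constructor
    · apply mul_le_mul _ e1 e3 (by positivity)
      gcongr
    · apply mul_le_mul _ e2 e4 (by nlinarith)
      gcongr
  have hlow : ∀ Q, IsCompact Q → Q ⊆ frontier L →
      ENNReal.ofReal c1 * μH[(n:ℝ) - 1] (N '' Q) ≤ μH[(n:ℝ) - 1] (dstar K Q) := by
    intro Q hQ hQL
    rw [hint Q hQ hQL, ← setLIntegral_const]
    apply setLIntegral_mono' (hNc Q hQ hQL).measurableSet
    rintro _ ⟨y, hy, rfl⟩
    exact ENNReal.ofReal_le_ofReal (hpt _ (hNs y (hQL hy))).1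
  have hup : ∀ Q, IsCompact Q → Q ⊆ frontier L →
      μH[(n:ℝ) - 1] (dstar K Q) ≤ ENNReal.ofReal c2 * μH[(n:ℝ) - 1] (N '' Q) := by
    intro Q hQ hQL
    rw [hint Q hQ hQL, ← setLIntegral_const]
    apply setLIntegral_mono' (hNc Q hQ hQL).measurableSet
    rintro _ ⟨y, hy, rfl⟩
    exact ENNReal.ofReal_le_ofReal (hpt _ (hNs y (hQL hy))).2
  have hs1 : ∀ Q, Q ⊆ frontier L →
      volume (coneS Q) ≤ ENNReal.ofReal (R' ^ n) * volume (coneS (N '' Q)) := by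
    intro Q hQ
    apply cone_scale hR'
    intro y hy
    have := hLb y (hQ hy)
    refine ⟨N y, ⟨y, hy, rfl⟩, ‖y‖, norm_nonneg _, this.2, ?_⟩
    have h0 : ‖y‖ ≠ 0 := by linarith
    simp [hN, smul_smul, mul_inv_cancel₀ h0]
  have hs2 : ∀ Q, Q ⊆ frontier L →
      volume (coneS (N '' Q)) ≤ ENNReal.ofReal (r'⁻¹ ^ n) * volume (coneS Q) := by
    intro Q hQ
    apply cone_scale (by positivity)
    rintro _ ⟨y, hy, rfl⟩
    have := hLb y (hQ hy)
    exact ⟨y, hy, ‖y‖⁻¹, by positivity, inv_anti₀ hr' this.1, rfl⟩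
  have hsph : ∀ Q, Q ⊆ frontier L → N '' Q ⊆ closedBall 0 (max R 1) := by
    rintro Q hQ _ ⟨y, hy, rfl⟩
    have := hNs y (hQ hy)
    rw [mem_closedBall_zero_iff]
    have h1 : ‖N y‖ = 1 := by simpa [unitSphere] using this
    rw [h1]; exact le_max_right _ _
  set A : ℝ≥0∞ := C1 * (ENNReal.ofReal c2 * (C3 * ENNReal.ofReal (r'⁻¹ ^ n))) with hA
  set B : ℝ≥0∞ := ENNReal.ofReal (R' ^ n) * (C1 * ((ENNReal.ofReal c1)⁻¹ * C2)) with hB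
  have hAtop : A ≠ ∞ := by finiteness
  have hc1' : ENNReal.ofReal c1 ≠ 0 := by simpa using hc1p
  have hBtop : B ≠ ∞ := by
    have : (ENNReal.ofReal c1)⁻¹ ≠ ∞ := ENNReal.inv_ne_top.2 hc1'
    finiteness
  refine ⟨A + B, by finiteness, ?_, ?_⟩
  · intro P hP hPK
    have hPK' : P ⊆ K := hPK.trans h.cK.isClosed.frontier_subset
    set Q := dstar L P with hQ
    have hQc : IsCompact Q := dstar_compact h.cL hP
    have hQL : Q ⊆ frontier L := dstar_subset h hPK'
    have hPQ : P ⊆ dstar K Q := by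
      intro x hx
      obtain ⟨hxK, y, hy, hxy⟩ := (h.frontier_iff x).1 (hPK hx)
      exact ⟨hxK, y, ⟨hy, x, hx, hxy⟩, by rw [real_inner_comm]; exact hxy⟩
    calc volume (coneS P) ≤ C1 * μH[(n:ℝ) - 1] P := hcone P (hPK'.trans (hKR.trans
            (closedBall_subset_closedBall (le_max_left _ _))))
      _ ≤ C1 * μH[(n:ℝ) - 1] (dstar K Q) := by gcongr
      _ ≤ C1 * (ENNReal.ofReal c2 * μH[(n:ℝ) - 1] (N '' Q)) := by gcongr; exact hup Q hQc hQL
      _ ≤ C1 * (ENNReal.ofReal c2 * (C3 * volume (coneS (N '' Q)))) := by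
          gcongr; apply hhaus1 _ (hNc Q hQc hQL)
          rintro _ ⟨y, hy, rfl⟩; exact hNs y (hQL hy)
      _ ≤ C1 * (ENNReal.ofReal c2 * (C3 * (ENNReal.ofReal (r'⁻¹ ^ n) * volume (coneS Q)))) := by
          gcongr; exact hs2 Q hQL
      _ = A * volume (coneS Q) := by rw [hA]; ring
      _ ≤ _ := by gcongr; exact le_self_add
  · intro Q hQ hQL
    have hQK : dstar K Q ⊆ frontier K := dstar_subset h.symm (hQL.trans h.cL.isClosed.frontier_subset)
    calc volume (coneS Q) ≤ ENNReal.ofReal (R' ^ n) * volume (coneS (N '' Q)) := hs1 Q hQL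
      _ ≤ ENNReal.ofReal (R' ^ n) * (C1 * μH[(n:ℝ) - 1] (N '' Q)) := by
          gcongr; exact hcone _ (hsph Q hQL)
      _ ≤ ENNReal.ofReal (R' ^ n) * (C1 * ((ENNReal.ofReal c1)⁻¹ * μH[(n:ℝ) - 1] (dstar K Q))) := by
          gcongr
          have := hlow Q hQ hQL
          rw [mul_comm] at this
          rw [mul_comm (_)⁻¹]
          rw [← div_eq_mul_inv]
          exact (ENNReal.le_div_iff_mul_le (Or.inl hc1') (Or.inl ENNReal.ofReal_ne_top)).2 this
      _ ≤ ENNReal.ofReal (R' ^ n) * (C1 * ((ENNReal.ofReal c1)⁻¹ * (C2 * volume (coneS (dstar K Q))))) := by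
          gcongr; exact hhaus _ (dstar_compact h.cK hQ) hQK
      _ = B * volume (coneS (dstar K Q)) := by rw [hB]; ring
      _ ≤ _ := by gcongr; exact le_add_self


/-- determinant of a family of vectors -/
def DD {n : ℕ} : (Eu n) [⋀^Fin n]→ₗ[ℝ] ℝ := (EuclideanSpace.basisFun (Fin n) ℝ).toBasis.det

lemma DD_eq {n : ℕ} (v : Fin n → Eu n) : DD v = Matrix.det (Matrix.of fun i j => v i j) := by
  rw [← Matrix.det_transpose]
  simp only [DD, Module.Basis.det_apply]
  congr 1

def lin {n : ℕ} (g : Fin n → Eu n) : Eu n →ₗ[ℝ] Eu n where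
  toFun x := ∑ i, x i • g i
  map_add' x y := by simp [add_smul, Finset.sum_add_distrib]
  map_smul' c x := by simp [mul_smul, Finset.smul_sum]

lemma lin_apply {n : ℕ} (g : Fin n → Eu n) (x : Eu n) : lin g x = ∑ i, x i • g i := rfl

lemma det_lin {n : ℕ} (g : Fin n → Eu n) : LinearMap.det (lin g) = DD g := by
  have h := (EuclideanSpace.basisFun (Fin n) ℝ).toBasis.det_comp (lin g)
    (EuclideanSpace.basisFun (Fin n) ℝ).toBasis
  rw [Module.Basis.det_self, mul_one] at h
  rw [← h]
  unfold DD
  congr 1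
  ext1 i
  simp only [Function.comp, lin_apply]
  rw [Finset.sum_eq_single i]
  · simp
  · intro j _ hj; simp [hj]
  · simp

lemma vol_lin {n : ℕ} (g : Fin n → Eu n) (X : Set (Eu n)) :
    volume (lin g '' X) = ENNReal.ofReal |DD g| * volume X := by
  rw [Measure.addHaar_image_linearMap, det_lin]

lemma DD_update {n : ℕ} (v : Fin n → Eu n) (i : Fin n) (c : Fin n → ℝ) :
    DD (Function.update v i (∑ j, c j • v j)) = c i * DD v := by
  rw [AlternatingMap.map_update_sum]
  simp_rw [AlternatingMap.map_update_smul]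
  rw [Finset.sum_eq_single i]
  · simp
  · intro j _ hj
    rw [AlternatingMap.map_update_self _ _ (Ne.symm hj), smul_zero]
  · simp

lemma exists_indep {n : ℕ} {S : Set (Eu n)} (hs : Submodule.span ℝ S = ⊤) :
    ∃ v : Fin n → Eu n, (∀ i, v i ∈ S) ∧ DD v ≠ 0 := by
  let b := Module.Basis.ofSpan (K := ℝ) hs.ge
  have b0 := (EuclideanSpace.basisFun (Fin n) ℝ).toBasis
  let e := b.indexEquiv b0
  refine ⟨b.reindex e, fun i => ?_, ?_⟩
  · rw [Module.Basis.reindex_apply]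
    exact Module.Basis.ofSpan_subset hs.ge ⟨_, rfl⟩
  · exact ((EuclideanSpace.basisFun (Fin n) ℝ).toBasis.isUnit_det (b.reindex e)).ne_zero

lemma basis_of_DD {n : ℕ} {v : Fin n → Eu n} (hv : DD v ≠ 0) :
    ∃ b : Module.Basis (Fin n) ℝ (Eu n), ⇑b = v := by
  have := (Module.Basis.is_basis_iff_det (EuclideanSpace.basisFun (Fin n) ℝ).toBasis (v := v)).2
    (isUnit_iff_ne_zero.2 hv)
  exact ⟨Module.Basis.mk this.1 this.2.ge, by simp⟩

lemma exists_max {n : ℕ} {S : Set (Eu n)} (hS : IsCompact S) (hs : Submodule.span ℝ S = ⊤) :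
    ∃ v : Fin n → Eu n, (∀ i, v i ∈ S) ∧ DD v ≠ 0 ∧
      ∀ s ∈ S, ∃ c : Fin n → ℝ, (∀ i, |c i| ≤ 1) ∧ s = ∑ i, c i • v i := by
  obtain ⟨v0, hv0, hd0⟩ := exists_indep hs
  have hcont : Continuous fun v : Fin n → Eu n => |DD v| := by
    have : (fun v : Fin n → Eu n => |DD v|) = fun v => |Matrix.det (Matrix.of fun i j => v i j)| := by
      ext v; rw [DD_eq]
    rw [this]
    apply Continuous.abs
    apply Continuous.matrix_det
    apply continuous_matrix
    intro i j
    simp only [Matrix.of_apply]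
    fun_prop
  obtain ⟨v, hv, hmax⟩ := (isCompact_univ_pi fun _ : Fin n => hS).exists_isMaxOn
    ⟨v0, fun i _ => hv0 i⟩ hcont.continuousOn
  have hmax' : ∀ u : Fin n → Eu n, (∀ i, u i ∈ S) → |DD u| ≤ |DD v| := fun u hu => hmax (fun i _ => hu i)
  have hdv : 0 < |DD v| := lt_of_lt_of_le (abs_pos.2 hd0) (hmax' v0 hv0)
  refine ⟨v, fun i => hv i trivial, abs_pos.1 hdv, fun s hs => ?_⟩
  obtain ⟨b, hb⟩ := basis_of_DD (abs_pos.1 hdv)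
  have hsum : s = ∑ i, b.repr s i • v i := by rw [← hb]; exact (b.sum_repr s).symm
  refine ⟨fun i => b.repr s i, fun i => ?_, hsum⟩
  have h1 := hmax' (Function.update v i s) (fun j => by
    by_cases hj : j = i
    · subst hj; simpa using hs
    · rw [Function.update_of_ne hj]; exact hv j trivial)
  have h2 : DD (Function.update v i s) = b.repr s i * DD v := by
    conv_lhs => rw [hsum]
    exact DD_update v i _
  rw [h2, abs_mul] at h1
  exact le_of_mul_le_mul_right (by linarith) hdv

lemma exists_dual {n : ℕ} {v : Fin n → Eu n} (hv : DD v ≠ 0) :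
    ∃ u : Fin n → Eu n, (∀ i j, ⟪u i, v j⟫ = if i = j then 1 else 0) ∧ DD v * DD u = 1 ∧
      (∀ x, x = ∑ i, ⟪u i, x⟫ • v i) ∧ (∀ y, y = ∑ i, ⟪v i, y⟫ • u i) := by
  obtain ⟨b, hb⟩ := basis_of_DD hv
  let u : Fin n → Eu n := fun i =>
    (InnerProductSpace.toDual ℝ (Eu n)).symm (LinearMap.toContinuousLinearMap (b.coord i))
  have hu : ∀ i x, ⟪u i, x⟫ = b.repr x i := fun i x => by
    simp only [u, InnerProductSpace.toDual_symm_apply]; rfl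
  have h1 : ∀ i j, ⟪u i, v j⟫ = if i = j then 1 else 0 := by
    intro i j
    rw [hu, ← hb, b.repr_self, Finsupp.single_apply]
    simp [eq_comm]
  have h3 : ∀ x, x = ∑ i, ⟪u i, x⟫ • v i := by
    intro x
    simp_rw [hu]
    rw [← hb]; exact (b.sum_repr x).symm
  refine ⟨u, h1, ?_, h3, ?_⟩
  · rw [DD_eq, DD_eq, mul_comm, ← Matrix.det_transpose (Matrix.of fun i j => v i j), ← Matrix.det_mul]
    rw [← Matrix.det_one (n := Fin n) (R := ℝ)]
    congr 1
    ext i j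
    rw [Matrix.mul_apply, Matrix.one_apply, ← h1 i j, PiLp.inner_apply]
    simp [mul_comm]
  · intro y
    apply ext_inner_left ℝ
    intro x
    rw [inner_sum]
    conv_lhs => rw [h3 x, sum_inner]
    apply Finset.sum_congr rfl
    intro i _
    rw [inner_smul_left, inner_smul_right, real_inner_comm x]
    simp [mul_comm]

lemma DD_shift {n : ℕ} {g g' : Fin n → Eu n} (k : Fin n) (α : Fin n → ℝ) (hα : α k = 0)
    (h : ∀ i, g i = g' i + α i • g k) : DD g = DD g' := by
  rw [DD_eq, DD_eq]
  apply Matrix.det_eq_of_forall_row_eq_smul_add_const α k hα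
  intro i j
  simp only [Matrix.of_apply]
  conv_lhs => rw [h i]
  have : g k = g' k := by have := h k; rw [hα, zero_smul, add_zero] at this; exact this
  simp [this]

lemma DD_smul {n : ℕ} (s : Fin n → ℝ) (g : Fin n → Eu n) :
    DD (fun i => s i • g i) = (∏ i, s i) * DD g := by
  have := (DD (n := n)).toMultilinearMap.map_smul_univ s g
  simpa using this

lemma DD_w {n : ℕ} (u : Fin n → Eu n) (i0 : Fin n) (w : Eu n) (hw : w = ∑ i, u i) :
    DD (Function.update u i0 w) = DD u := by
  have := DD_update u i0 (fun _ => 1)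
  simpa [← hw] using this

lemma prod_upd {n : ℕ} (i0 : Fin n) (a : ℝ) :
    ∏ i, (Function.update (fun _ : Fin n => a) i0 1) i = a ^ (n-1) := by
  rw [Finset.prod_update_of_mem (Finset.mem_univ _)]
  simp [Finset.card_sdiff]

lemma DD_A {n : ℕ} (u : Fin n → Eu n) (i0 : Fin n) (w : Eu n) (hw : w = ∑ i, u i) (κ : ℝ) :
    DD (Function.update (fun i => κ • u i) i0 w) = κ ^ (n-1) * DD u := by
  rw [← DD_w u i0 w hw, ← prod_upd i0 κ, ← DD_smul]
  congr 1
  ext1 i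
  by_cases hi : i = i0
  · subst hi; simp
  · simp [hi]

lemma DD_B {n : ℕ} (u : Fin n → Eu n) {i0 b : Fin n} (hb : b ≠ i0) (w : Eu n) (hw : w = ∑ i, u i)
    (a : ℝ) (ξ : Fin n → ℝ) (α : Fin n → ℝ) (hα : α i0 = 0) (g : Fin n → Eu n)
    (hg0 : g i0 = w) (hgb : g b = a • (∑ i, ξ i • u i) + α b • w)
    (hg : ∀ i, i ≠ i0 → i ≠ b → g i = a • u i + α i • w) :
    DD g = a ^ (n-1) * (ξ b - ξ i0) * DD u := by
  set u' := Function.update u i0 w with hu'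
  set c : Fin n → ℝ := fun i => if i = i0 then ξ i0 else ξ i - ξ i0 with hc
  have hsum : ∑ i, ξ i • u i = ∑ i, c i • u' i := by
    have h1 : ∀ i ∈ (Finset.univ : Finset (Fin n)), c i • u' i
        = ξ i • u i - ξ i0 • u i + (if i = i0 then ξ i0 • w else 0) := by
      intro i _
      by_cases hi : i = i0
      · subst hi; simp [hc, hu']
      · simp [hc, hu', hi, sub_smul]
    rw [Finset.sum_congr rfl h1, Finset.sum_add_distrib, Finset.sum_sub_distrib, ← Finset.smul_sum, ← hw]
    simp
  have h2 : DD g = DD (fun i => (Function.update (fun _ : Fin n => a) i0 1) i •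
      (Function.update u' b (∑ i, c i • u' i)) i) := by
    apply DD_shift i0 α hα
    intro i
    rw [hg0]
    by_cases hi : i = i0
    · subst hi; simp [hα, Ne.symm hb, hg0, hu']
    by_cases hib : i = b
    · subst hib; simp [hi, hgb, hsum]
    · simp [hi, hib, hu', hg i hi hib]
  rw [h2, DD_smul, prod_upd, DD_update, DD_w u i0 w hw]
  simp [hc, hb, mul_assoc]


lemma DualPair.ray {n : ℕ} {K L : Set (Eu n)} (h : DualPair K L) {z : Eu n} (hz : z ∈ K)
    (hz0 : z ≠ 0) : ∃ x ∈ frontier K, ∃ s : ℝ, 0 < s ∧ s ≤ 1 ∧ z = s • x := by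
  obtain ⟨y, hy, hmax⟩ := h.cL.exists_isMaxOn ⟨0, interior_subset h.iL⟩
      (f := fun y => ⟪z, y⟫) (by fun_prop)
  have hmax' : ∀ y' ∈ L, ⟪z, y'⟫ ≤ ⟪z, y⟫ := fun y' hy' => hmax hy'
  have hzn : 0 < ‖z‖ := norm_pos_iff.2 hz0
  have hpos : 0 < ⟪z, y⟫ := by
    obtain ⟨r, hr, hrL⟩ := ball_of_int h.iL
    have hm : (r / (2 * ‖z‖)) • z ∈ L := by
      apply hrL
      rw [mem_ball_zero_iff, norm_smul, Real.norm_of_nonneg (by positivity)]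
      field_simp; linarith
    have h1 := hmax' _ hm
    rw [inner_smul_right, real_inner_self_eq_norm_sq] at h1
    have : 0 < r / (2 * ‖z‖) * ‖z‖ ^ 2 := by positivity
    linarith
  have hxy : ∀ y', ⟪⟪z, y⟫⁻¹ • z, y'⟫ = ⟪z, y⟫⁻¹ * ⟪z, y'⟫ := fun y' => by
    rw [inner_smul_left]; simp
  refine ⟨⟪z, y⟫⁻¹ • z, ?_, ⟪z, y⟫, hpos, h.le hz hy, ?_⟩
  · rw [h.frontier_iff]
    refine ⟨?_, y, hy, ?_⟩
    · rw [h.hK]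
      intro y' hy'
      rw [real_inner_comm, hxy, inv_mul_le_iff₀ hpos, mul_one]
      exact hmax' y' hy'
    · rw [hxy, inv_mul_cancel₀ hpos.ne']
  · rw [smul_smul, mul_inv_cancel₀ hpos.ne', one_smul]

def Cube (n : ℕ) (c : ℝ) : Set (Eu n) := {x | ∀ i, |x i| ≤ c}

lemma Cube_fin (n : ℕ) (c : ℝ) : volume (Cube n c) < ∞ := by
  have : Cube n c ⊆ closedBall 0 (√(n * c ^ 2)) := by
    intro x hx
    rw [mem_closedBall_zero_iff, EuclideanSpace.norm_eq]
    apply Real.sqrt_le_sqrt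
    calc ∑ i, ‖x i‖ ^ 2 ≤ ∑ i : Fin n, c ^ 2 := by
          apply Finset.sum_le_sum
          intro i _
          rw [Real.norm_eq_abs]
          exact pow_le_pow_left₀ (abs_nonneg _) (hx i) 2
      _ = _ := by simp
  exact (measure_mono this).trans_lt measure_closedBall_lt_top

lemma coneS_cube {n : ℕ} {P : Set (Eu n)} {g : Fin n → Eu n} {c : ℝ}
    (h : P ⊆ lin g '' Cube n c) : coneS P ⊆ lin g '' Cube n c := by
  rintro _ ⟨s, hs, x, hx, rfl⟩
  obtain ⟨a, ha, rfl⟩ := h hx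
  refine ⟨s • a, fun i => ?_, by rw [map_smul]⟩
  have := ha i
  simp only [PiLp.smul_apply, smul_eq_mul, abs_mul, abs_of_nonneg hs.1]
  nlinarith [abs_nonneg (a i), hs.1, hs.2]

def OpA (n : ℕ) : Set (Eu n) :=
  {x | (∀ i, 0 < x i) ∧ ∑ i, x i < 1 ∧ ∀ i, (∑ j, x j) / (2 * n) < x i}

lemma OpA_fin (n : ℕ) : volume (OpA n) < ∞ := by
  refine (measure_mono ?_).trans_lt (Cube_fin n 1)
  rintro x ⟨h1, h2, -⟩ i
  rw [abs_of_pos (h1 i)]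
  exact (Finset.single_le_sum (fun j _ => (h1 j).le) (Finset.mem_univ i)).trans h2.le

def OpB (n : ℕ) : Set (Eu n) := {x | (∀ i, 0 < x i) ∧ ∑ i, x i < 1 / 4}

lemma OpB_fin (n : ℕ) : volume (OpB n) < ∞ := by
  refine (measure_mono ?_).trans_lt (Cube_fin n (1/4))
  rintro x ⟨h1, h2⟩ i
  rw [abs_of_pos (h1 i)]
  exact (Finset.single_le_sum (fun j _ => (h1 j).le) (Finset.mem_univ i)).trans h2.le

lemma OpA_pos {n : ℕ} (hn : 2 ≤ n) : 0 < volume (OpA n) := by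
  have ho : IsOpen (OpA n) := by
    have : OpA n = (⋂ i, {x : Eu n | 0 < x i}) ∩ ({x : Eu n | ∑ i, x i < 1} ∩
        ⋂ i, {x : Eu n | (∑ j, x j) / (2 * n) < x i}) := by
      ext; simp [OpA]
    rw [this]
    refine (isOpen_iInter_of_finite fun i => isOpen_lt (by fun_prop) (by fun_prop)).inter
      ((isOpen_lt (by fun_prop) (by fun_prop)).inter
      (isOpen_iInter_of_finite fun i => isOpen_lt (by fun_prop) (by fun_prop)))
  refine ho.measure_pos volume ?_
  have hn0 : (0:ℝ) < n := by positivity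
  have hs : ∑ i : Fin n, (1 / (2 * n) : ℝ) = 1 / 2 := by
    simp; field_simp
  refine ⟨WithLp.toLp 2 fun _ => 1 / (2 * n), fun i => ?_, ?_, fun i => ?_⟩
  · simp only; positivity
  · simp only [hs]; norm_num
  · simp only [hs]
    gcongr; norm_num

lemma OpB_pos {n : ℕ} (hn : 2 ≤ n) : 0 < volume (OpB n) := by
  have ho : IsOpen (OpB n) := by
    have : OpB n = (⋂ i, {x : Eu n | 0 < x i}) ∩ {x : Eu n | ∑ i, x i < 1 / 4} := by
      ext; simp [OpB]
    rw [this]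
    exact (isOpen_iInter_of_finite fun i => isOpen_lt (by fun_prop) (by fun_prop)).inter
      (isOpen_lt (by fun_prop) (by fun_prop))
  refine ho.measure_pos volume ?_
  have hn0 : (0:ℝ) < n := by positivity
  have hs : ∑ i : Fin n, (1 / (8 * n) : ℝ) = 1 / 8 := by
    simp; field_simp
  refine ⟨WithLp.toLp 2 fun _ => 1 / (8 * n), fun i => ?_, ?_⟩
  · simp only; positivity
  · simp only [hs]; norm_num

lemma inner_lin_dual {n : ℕ} {v u : Fin n → Eu n}
    (huv : ∀ i j, ⟪u i, v j⟫ = if i = j then 1 else 0) (i : Fin n) (x : Eu n) :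
    ⟪u i, lin v x⟫ = x i := by
  rw [lin_apply, inner_sum]
  simp [inner_smul_right, huv]

lemma inner_w {n : ℕ} {u : Fin n → Eu n} {w : Eu n} (hw : w = ∑ i, u i) (x : Eu n) :
    ⟪w, x⟫ = ∑ i, ⟪u i, x⟫ := by rw [hw, sum_inner]

lemma partA {n : ℕ} (hn : 2 ≤ n) {K L : Set (Eu n)} (h : DualPair K L) {C : ℝ≥0∞}
    (hB : Bnd C K L) {v u : Fin n → Eu n} {w : Eu n} {m : ℝ} (i0 : Fin n)
    (huv : ∀ i j, ⟪u i, v j⟫ = if i = j then 1 else 0)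
    (hv : ∀ x, x = ∑ i, ⟪u i, x⟫ • v i) (hu : ∀ y, y = ∑ i, ⟪v i, y⟫ • u i)
    (hvK : ∀ i, v i ∈ K) (hw : w = ∑ i, u i) (hm : 0 < m) (hnm : n * m ≤ 1)
    (hKw : ∀ x ∈ K, ⟪w, x⟫ ≤ 1 + m) :
    ENNReal.ofReal |DD v| * volume (OpA n) ≤
      C * (ENNReal.ofReal ((2 * n * m) ^ (n-1) * |DD u|) * volume (Cube n 1)) := by
  have hn0 : (0:ℝ) < n := by positivity
  set P : Set (Eu n) := frontier K ∩ {x | ∀ i, ⟪w, x⟫ / (2 * n) ≤ ⟪u i, x⟫} with hP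
  have hPc : IsCompact P := by
    apply (h.cK.of_isClosed_subset isClosed_frontier h.cK.isClosed.frontier_subset).inter_right
    have : {x : Eu n | ∀ i, ⟪w, x⟫ / (2 * n) ≤ ⟪u i, x⟫} =
      ⋂ i, {x : Eu n | ⟪w, x⟫ / (2 * n) ≤ ⟪u i, x⟫} := by ext; simp
    rw [this]
    exact isClosed_iInter fun i => isClosed_le (by fun_prop) (by fun_prop)
  have h1 := hB P hPc inter_subset_left
  have h2 : lin v '' OpA n ⊆ coneS P := by
    rintro _ ⟨a, ⟨ha1, ha2, ha3⟩, rfl⟩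
    have hco := fun i => inner_lin_dual huv i a
    have hwz : ⟪w, lin v a⟫ = ∑ i, a i := by rw [inner_w hw]; simp_rw [hco]
    have hz0 : lin v a ≠ 0 := by
      intro h0
      have := ha1 i0
      rw [← hco i0, h0, inner_zero_right] at this
      exact lt_irrefl _ this
    have hzK : lin v a ∈ K := by
      rw [h.hK]
      intro y hy
      rw [lin_apply, inner_sum]
      calc ∑ i, ⟪y, a i • v i⟫ ≤ ∑ i, a i := by
            apply Finset.sum_le_sum
            intro i _
            rw [inner_smul_right, real_inner_comm]
            have := h.le (hvK i) hy
            nlinarith [ha1 i]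
        _ ≤ 1 := ha2.le
    obtain ⟨x, hx, s, hs0, hs1, hzx⟩ := h.ray hzK hz0
    refine ⟨s, ⟨hs0.le, hs1⟩, x, ⟨hx, fun i => ?_⟩, hzx⟩
    have e1 : s * ⟪u i, x⟫ = a i := by rw [← hco i, hzx, inner_smul_right]
    have e2 : s * ⟪w, x⟫ = ∑ i, a i := by rw [← hwz, hzx, inner_smul_right]
    have := ha3 i
    rw [← e1, ← e2, mul_div_assoc] at this
    exact (lt_of_mul_lt_mul_left this hs0.le).le
  set κ : ℝ := 2 * n * m with hκ
  have hκ0 : 0 < κ := by positivity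
  have h3 : dstar L P ⊆ lin (Function.update (fun i => κ • u i) i0 w) '' Cube n 1 := by
    rintro y ⟨hy, x, ⟨hxf, hx⟩, hxy⟩
    have hxK : x ∈ K := h.cK.isClosed.frontier_subset hxf
    have hsum : ∑ i, ⟪u i, x⟫ * ⟪v i, y⟫ = 1 := by
      rw [← hxy]
      conv_rhs => rw [hv x, sum_inner]
      simp [inner_smul_left]
    have hd : ∀ i, ⟪v i, y⟫ ≤ 1 := fun i => h.le (hvK i) hy
    set σ := ⟪w, x⟫ with hσ
    have hσs : σ = ∑ i, ⟪u i, x⟫ := inner_w hw x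
    have hσ0 : 0 ≤ σ := by
      by_contra hneg
      push Not at hneg
      have hle : ∑ i : Fin n, σ / (2 * n) ≤ σ := by
        conv_rhs => rw [hσs]
        exact Finset.sum_le_sum fun i _ => hx i
      have : ∑ i : Fin n, σ / (2 * n) = σ / 2 := by simp; field_simp
      linarith
    have hxi : ∀ i, 0 ≤ ⟪u i, x⟫ := fun i => le_trans (by positivity) (hx i)
    have hdsum : ∑ i, ⟪u i, x⟫ * (1 - ⟪v i, y⟫) = σ - 1 := by
      simp_rw [mul_sub, mul_one]
      rw [Finset.sum_sub_distrib, hsum, ← hσs]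
    have hnn : ∀ i, 0 ≤ ⟪u i, x⟫ * (1 - ⟪v i, y⟫) := fun i =>
      mul_nonneg (hxi i) (by linarith [hd i])
    have hσ1 : 1 ≤ σ := by
      have := Finset.sum_nonneg fun i (_ : i ∈ Finset.univ) => hnn i
      linarith
    have hσm : σ ≤ 1 + m := hKw x hxK
    have hdi : ∀ i, 1 - ⟪v i, y⟫ ≤ κ := by
      intro i
      have e1 : ⟪u i, x⟫ * (1 - ⟪v i, y⟫) ≤ m := by
        have := Finset.single_le_sum (fun i (_ : i ∈ Finset.univ) => hnn i) (Finset.mem_univ i)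
        linarith
      have e2 : 1 / (2 * n) ≤ ⟪u i, x⟫ := le_trans (by gcongr) (hx i)
      have e3 : 1 / (2 * n) * (1 - ⟪v i, y⟫) ≤ m :=
        le_trans (mul_le_mul_of_nonneg_right e2 (by linarith [hd i])) e1
      rw [div_mul_eq_mul_div, one_mul, div_le_iff₀ (by positivity)] at e3
      rw [hκ]; linarith
    refine ⟨WithLp.toLp 2 (fun i => if i = i0 then ⟪v i0, y⟫ else (⟪v i, y⟫ - ⟪v i0, y⟫) / κ),
      fun i => ?_, ?_⟩
    · simp only
      split_ifs with hi
      · rw [abs_le]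
        have := hdi i0
        constructor
        · rw [hκ] at this; nlinarith
        · exact hd i0
      · rw [abs_div, abs_of_pos hκ0, div_le_one hκ0, abs_le]
        constructor <;> linarith [hd i, hd i0, hdi i, hdi i0]
    · rw [lin_apply]
      have : ∀ i ∈ (Finset.univ : Finset (Fin n)),
        (if i = i0 then ⟪v i0, y⟫ else (⟪v i, y⟫ - ⟪v i0, y⟫) / κ) •
          (Function.update (fun i => κ • u i) i0 w) i =
          ⟪v i, y⟫ • u i - ⟪v i0, y⟫ • u i + (if i = i0 then ⟪v i0, y⟫ • w else 0) := by
        intro i _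
        by_cases hi : i = i0
        · subst hi; simp
        · simp only [hi, if_false, Function.update_of_ne, ne_eq, not_false_eq_true, smul_smul,
            div_mul_cancel₀ _ hκ0.ne', sub_smul, add_zero]
      simp only
      rw [Finset.sum_congr rfl this, Finset.sum_add_distrib, Finset.sum_sub_distrib, ← Finset.smul_sum,
        ← hw, ← hu y]
      simp
  have h4 := measure_mono (μ := volume) (coneS_cube h3)
  rw [vol_lin, DD_A u i0 w hw, abs_mul, abs_of_nonneg (by positivity : 0 ≤ κ ^ (n-1))] at h4
  calc ENNReal.ofReal |DD v| * volume (OpA n) = volume (lin v '' OpA n) := (vol_lin _ _).symm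
    _ ≤ volume (coneS P) := measure_mono h2
    _ ≤ _ := h1
    _ ≤ _ := by gcongr

lemma partB {n : ℕ} {K L : Set (Eu n)} (h : DualPair K L) {C : ℝ≥0∞}
    (hB : Bnd C L K) {v u g : Fin n → Eu n} {w x0 : Eu n} {m0 : ℝ} (i0 : Fin n)
    (hv : ∀ x, x = ∑ i, ⟪u i, x⟫ • v i)
    (hS : ∀ s ∈ K, ⟪w, s⟫ = 1 → ∀ i, |⟪u i, s⟫| ≤ 1)
    (hm0 : 0 < m0) (hm1 : m0 ≤ 1)
    (hKw : ∀ x ∈ K, ⟪w, x⟫ ≤ 2) (hx0 : x0 ∈ K) (hx0w : ⟪w, x0⟫ = 1 + m0)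
    (hg : DD g ≠ 0) (hx0g : ∀ i, ⟪g i, x0⟫ = 1 + m0)
    (hSg : ∀ s ∈ K, ⟪w, s⟫ = 1 → ∀ i, ⟪g i, s⟫ ≤ 1 + m0 / 2) :
    ENNReal.ofReal |DD g| * volume (OpB n) ≤
      C * (ENNReal.ofReal |DD v| * volume (Cube n 2)) := by
  obtain ⟨gd, hgd, -, hgd2, -⟩ := exists_dual hg
  have hYs : ∀ (c : Fin n → ℝ), (∀ i, 0 ≤ c i) → ∀ s ∈ K, ⟪w, s⟫ = 1 →
      ⟪∑ i, c i • g i, s⟫ ≤ (1 + m0 / 2) * ∑ i, c i := by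
    intro c hc s hs hws
    rw [sum_inner, Finset.mul_sum]
    apply Finset.sum_le_sum
    intro i _
    rw [inner_smul_left]
    simp only [conj_trivial]
    nlinarith [hSg s hs hws i, hc i]
  have hY0 : ∀ (c : Fin n → ℝ), ⟪∑ i, c i • g i, x0⟫ = (1 + m0) * ∑ i, c i := by
    intro c
    rw [sum_inner, Finset.mul_sum]
    apply Finset.sum_congr rfl
    intro i _
    rw [inner_smul_left, hx0g i]
    simp [mul_comm]
  have key : ∀ (c : Fin n → ℝ), (∀ i, 0 ≤ c i) → 0 < ∑ i, c i → ∀ x ∈ K,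
      (1 + m0) * ∑ i, c i ≤ ⟪∑ i, c i • g i, x⟫ → 1 ≤ ⟪w, x⟫ := by
    intro c hc hσ x hx hle
    by_contra hlt
    push Not at hlt
    set a := ⟪w, x⟫ with ha
    have hden : 0 < 1 + m0 - a := by linarith
    set θ := (1 - a) / (1 + m0 - a) with hθ
    have hθ0 : 0 ≤ θ := div_nonneg (by linarith) hden.le
    have hθ1 : θ ≤ 1 := by rw [hθ, div_le_one hden]; linarith
    have hθe : θ * (1 + m0 - a) = 1 - a := div_mul_cancel₀ _ hden.ne'
    have hsK : (1 - θ) • x + θ • x0 ∈ K := h.vK hx hx0 (by linarith) hθ0 (by ring)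
    have hsw : ⟪w, (1 - θ) • x + θ • x0⟫ = 1 := by
      rw [inner_add_right, inner_smul_right, inner_smul_right, hx0w, ← ha]
      linarith
    have h1 := hYs c hc _ hsK hsw
    rw [inner_add_right, inner_smul_right, inner_smul_right, hY0] at h1
    have h2 := mul_le_mul_of_nonneg_left hle (by linarith : 0 ≤ 1 - θ)
    nlinarith
  have hscale : ∀ x ∈ K, 1 ≤ ⟪w, x⟫ → ⟪w, x⟫⁻¹ • x ∈ K ∧ ⟪w, ⟪w, x⟫⁻¹ • x⟫ = 1 := by
    intro x hx hwx
    constructor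
    · exact h.vK.smul_mem_of_zero_mem (interior_subset h.iK) hx ⟨by positivity, inv_le_one_of_one_le₀ hwx⟩
    · rw [inner_smul_right, inv_mul_cancel₀ (by positivity)]
  have hup : ∀ (c : Fin n → ℝ), (∀ i, 0 ≤ c i) → 0 < ∑ i, c i → ∀ x ∈ K,
      ⟪∑ i, c i • g i, x⟫ ≤ 4 * ∑ i, c i := by
    intro c hc hσ x hx
    by_cases hwx : 1 ≤ ⟪w, x⟫
    · obtain ⟨h1, h2⟩ := hscale x hx hwx
      have h3 := hYs c hc _ h1 h2
      rw [inner_smul_right, inv_mul_le_iff₀ (by positivity)] at h3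
      have h4 := hKw x hx
      have h5 : (1 + m0 / 2) * ∑ i, c i ≤ 2 * ∑ i, c i := by gcongr; linarith
      have h6 : 0 ≤ (1 + m0 / 2) * ∑ i, c i := by positivity
      nlinarith
    · by_contra hlt
      push Not at hlt
      exact hwx (key c hc hσ x hx (by nlinarith))
  set Q : Set (Eu n) := frontier L ∩ {y | ∀ i, 0 ≤ ⟪gd i, y⟫} with hQ
  have hQc : IsCompact Q := by
    apply (h.cL.of_isClosed_subset isClosed_frontier h.cL.isClosed.frontier_subset).inter_right
    have : {y : Eu n | ∀ i, 0 ≤ ⟪gd i, y⟫} =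
      ⋂ i, {y : Eu n | 0 ≤ ⟪gd i, y⟫} := by ext; simp
    rw [this]
    exact isClosed_iInter fun i => isClosed_le (by fun_prop) (by fun_prop)
  have h1 := hB Q hQc inter_subset_left
  have h2 : lin g '' OpB n ⊆ coneS Q := by
    rintro _ ⟨a, ⟨ha1, ha2⟩, rfl⟩
    have hco := fun i => inner_lin_dual hgd i a
    have hpos : 0 < ∑ i, a i := Finset.sum_pos (fun i _ => ha1 i) ⟨i0, Finset.mem_univ _⟩
    have hz0 : lin g a ≠ 0 := by
      intro h0
      have := ha1 i0
      rw [← hco i0, h0, inner_zero_right] at this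
      exact lt_irrefl _ this
    have hzL : lin g a ∈ L := by
      rw [h.hL]
      intro x hx
      rw [real_inner_comm, lin_apply]
      have := hup (fun i => a i) (fun i => (ha1 i).le) hpos x hx
      linarith
    obtain ⟨y, hy, s, hs0, hs1, hzy⟩ := h.symm.ray hzL hz0
    refine ⟨s, ⟨hs0.le, hs1⟩, y, ⟨hy, fun i => ?_⟩, hzy⟩
    have e1 : s * ⟪gd i, y⟫ = a i := by rw [← hco i, hzy, inner_smul_right]
    have := ha1 i
    rw [← e1] at this
    exact (pos_of_mul_pos_right this hs0.le).le
  have h3 : dstar K Q ⊆ lin v '' Cube n 2 := by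
    rintro x ⟨hx, y, ⟨hyf, hy⟩, hyx⟩
    have hyL : y ∈ L := h.cL.isClosed.frontier_subset hyf
    have hye := hgd2 y
    have hσ : 0 < ∑ i, ⟪gd i, y⟫ := by
      apply lt_of_le_of_ne (Finset.sum_nonneg fun i _ => hy i)
      intro h0
      have h00 := (Finset.sum_eq_zero_iff_of_nonneg fun i _ => hy i).1 h0.symm
      have : y = 0 := by
        rw [hye]; apply Finset.sum_eq_zero; intro i hi; rw [h00 i hi, zero_smul]
      rw [this, inner_zero_left] at hyx
      exact zero_ne_one hyx
    have hwx : 1 ≤ ⟪w, x⟫ := by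
      apply key (fun i => ⟪gd i, y⟫) hy hσ x hx
      rw [← hY0, ← hye, hyx, real_inner_comm]
      exact h.le hx0 hyL
    obtain ⟨e1, e2⟩ := hscale x hx hwx
    refine ⟨WithLp.toLp 2 (fun i => ⟪u i, x⟫), fun i => ?_, ?_⟩
    · have h4 := hS _ e1 e2 i
      rw [inner_smul_right, abs_mul, abs_of_nonneg (by positivity), inv_mul_le_iff₀ (by positivity)] at h4
      have := hKw x hx
      simp only
      linarith
    · rw [lin_apply]; exact (hv x).symm
  have h4 := measure_mono (μ := volume) (coneS_cube h3)
  rw [vol_lin] at h4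
  calc ENNReal.ofReal |DD g| * volume (OpB n) = volume (lin g '' OpB n) := (vol_lin _ _).symm
    _ ≤ volume (coneS Q) := measure_mono h2
    _ ≤ _ := h1
    _ ≤ _ := by gcongr


lemma seg_setup {n : ℕ} {K L : Set (Eu n)} (h : DualPair K L) {a b : Eu n} (hab : a ≠ b)
    (hseg : segment ℝ a b ⊆ frontier K) :
    ∃ (y0 ξ x0 q : Eu n) (δ : ℝ), 0 < δ ∧ y0 ∈ L ∧ x0 ∈ K ∧ q ∈ K ∧ ⟪y0, x0⟫ = 1 ∧ ⟪y0, q⟫ = 1 ∧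
      ⟪ξ, x0⟫ = δ ∧ ⟪ξ, q⟫ = -δ ∧ ∀ x ∈ K, ⟪y0, x⟫ = 1 → ⟪ξ, x⟫ ≤ δ := by
  have haK : a ∈ K := h.cK.isClosed.frontier_subset (hseg (left_mem_segment ℝ a b))
  have hbK : b ∈ K := h.cK.isClosed.frontier_subset (hseg (right_mem_segment ℝ a b))
  have hmid := hseg (midpoint_mem_segment (𝕜 := ℝ) a b)
  obtain ⟨-, y0, hy0, hm⟩ := (h.frontier_iff _).1 hmid
  have h1 := h.le haK hy0
  have h2 := h.le hbK hy0
  rw [midpoint_eq_smul_add, inner_smul_left, inner_add_left] at hm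
  simp only [conj_trivial, invOf_eq_inv] at hm
  have ha : ⟪y0, a⟫ = 1 := by rw [real_inner_comm]; linarith
  have hb : ⟪y0, b⟫ = 1 := by rw [real_inner_comm]; linarith
  set F : Set (Eu n) := K ∩ {x | ⟪y0, x⟫ = 1} with hF
  have hFc : IsCompact F := h.cK.inter_right (isClosed_eq (by fun_prop) continuous_const)
  set η := a - b with hη
  obtain ⟨x0, hx0, hmax⟩ := hFc.exists_isMaxOn ⟨a, haK, ha⟩ (f := fun x => ⟪η, x⟫) (by fun_prop)
  have hmax' : ∀ x ∈ F, ⟪η, x⟫ ≤ ⟪η, x0⟫ := fun x hx => hmax hx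
  have hlt : ⟪η, b⟫ < ⟪η, x0⟫ := by
    have e1 := hmax' a ⟨haK, ha⟩
    have e2 : 0 < ⟪η, η⟫ := by
      rw [real_inner_self_eq_norm_sq]
      have : 0 < ‖η‖ := norm_pos_iff.2 (sub_ne_zero.2 hab)
      positivity
    nth_rewrite 2 [hη] at e2
    rw [inner_sub_right] at e2
    linarith
  set c := (⟪η, x0⟫ + ⟪η, b⟫) / 2 with hc
  have hin : ∀ x, ⟪y0, x⟫ = 1 → ⟪η - c • y0, x⟫ = ⟪η, x⟫ - c := by
    intro x hx
    rw [inner_sub_left, inner_smul_left, hx]; simp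
  refine ⟨y0, η - c • y0, x0, b, (⟪η, x0⟫ - ⟪η, b⟫) / 2, by linarith, hy0, hx0.1, hbK, hx0.2, hb,
    ?_, ?_, ?_⟩
  · rw [hin _ hx0.2, hc]; ring
  · rw [hin _ hb, hc]; ring
  · intro x hx hxy
    rw [hin _ hxy]
    have := hmax' x ⟨hx, hxy⟩
    linarith

lemma eps_exists {n : ℕ} {K L : Set (Eu n)} (h : DualPair K L) {y0 ξ : Eu n} {δ t : ℝ}
    (hy0 : y0 ∈ L) (hδ : 0 < δ) (ht : 0 < t) (hF : ∀ x ∈ K, ⟪y0, x⟫ = 1 → ⟪ξ, x⟫ ≤ δ) :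
    ∃ ε1 : ℝ, 0 < ε1 ∧ ∀ ε : ℝ, 0 < ε → ε ≤ ε1 → ∀ x ∈ K, 1 ≤ ⟪y0 + ε • ξ, x⟫ → ⟪ξ, x⟫ ≤ δ + t := by
  obtain ⟨R, hR, hKR⟩ := h.cK.isBounded.subset_closedBall_lt 0 0
  set B := ‖ξ‖ * R + 1 with hBd
  have hB : 0 < B := by positivity
  have hKB : ∀ x ∈ K, ⟪ξ, x⟫ ≤ B := by
    intro x hx
    have h1 := real_inner_le_norm ξ x
    have h2 := hKR hx
    rw [mem_closedBall_zero_iff] at h2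
    nlinarith [norm_nonneg ξ]
  set T : Set (Eu n) := K ∩ {x | δ + t ≤ ⟪ξ, x⟫} with hT
  have hTc : IsCompact T := h.cK.inter_right (isClosed_le continuous_const (by fun_prop))
  have hM : ∃ M < 1, ∀ x ∈ T, ⟪y0, x⟫ ≤ M := by
    rcases T.eq_empty_or_nonempty with h0 | hne
    · exact ⟨0, one_pos, by simp [h0]⟩
    · obtain ⟨x1, hx1, hmax⟩ := hTc.exists_isMaxOn hne (f := fun x => ⟪y0, x⟫) (by fun_prop)
      refine ⟨⟪y0, x1⟫, ?_, fun x hx => hmax hx⟩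
      apply lt_of_le_of_ne
      · rw [real_inner_comm]; exact h.le hx1.1 hy0
      · intro he
        have h1 := hF x1 hx1.1 he
        have h2 : δ + t ≤ ⟪ξ, x1⟫ := hx1.2
        linarith
  obtain ⟨M, hM1, hM2⟩ := hM
  refine ⟨(1 - M) / (2 * B), div_pos (by linarith) (by positivity), fun ε hε hε1 x hx hwx => ?_⟩
  by_contra hlt
  push Not at hlt
  have h1 := hM2 x ⟨hx, hlt.le⟩
  rw [inner_add_left, inner_smul_left] at hwx
  simp only [conj_trivial] at hwx
  rw [le_div_iff₀ (by positivity)] at hε1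
  have := hKB x hx
  nlinarith

lemma span_slice {n : ℕ} {K L : Set (Eu n)} (h : DualPair K L) {w x0 : Eu n}
    (hx0 : x0 ∈ K) (hw : 1 < ⟪w, x0⟫) :
    Submodule.span ℝ (K ∩ {x | ⟪w, x⟫ = 1}) = ⊤ := by
  set V := Submodule.span ℝ (K ∩ {x | ⟪w, x⟫ = 1}) with hV
  set U : Set (Eu n) := interior K ∩ {x | 1 < ⟪w, x⟫} with hU
  have hUo : IsOpen U := isOpen_interior.inter (isOpen_lt continuous_const (by fun_prop))
  have hUV : U ⊆ V := by
    rintro x ⟨hx, hwx⟩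
    have hwx' : 1 < ⟪w, x⟫ := hwx
    have hpos : 0 < ⟪w, x⟫ := by linarith
    have hm : ⟪w, x⟫⁻¹ • x ∈ K ∩ {x | ⟪w, x⟫ = 1} := by
      refine ⟨h.vK.smul_mem_of_zero_mem (interior_subset h.iK) (interior_subset hx)
        ⟨by positivity, inv_le_one_of_one_le₀ hwx'.le⟩, ?_⟩
      change ⟪w, ⟪w, x⟫⁻¹ • x⟫ = 1
      rw [inner_smul_right, inv_mul_cancel₀ hpos.ne']
    have := V.smul_mem ⟪w, x⟫ (Submodule.subset_span hm)
    rwa [smul_smul, mul_inv_cancel₀ hpos.ne', one_smul] at this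
  apply Submodule.eq_top_of_nonempty_interior'
  have hpos : 0 < ⟪w, x0⟫ := by linarith
  set θ : ℝ := (1 + ⟪w, x0⟫⁻¹) / 2 with hθ
  have hinv : ⟪w, x0⟫⁻¹ < 1 := inv_lt_one_of_one_lt₀ hw
  have hinv0 : 0 < ⟪w, x0⟫⁻¹ := by positivity
  refine ⟨θ • x0, mem_interior.2 ⟨U, hUV, hUo, ?_, ?_⟩⟩
  · have := h.vK.combo_interior_self_mem_interior h.iK hx0 (a := 1 - θ) (b := θ) (by linarith) (by linarith) (by ring)
    simpa using this
  · change 1 < ⟪w, θ • x0⟫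
    rw [inner_smul_right, hθ]
    have := inv_mul_cancel₀ hpos.ne'
    nlinarith

set_option maxHeartbeats 2000000 in
lemma one_step {n : ℕ} (hn : 2 ≤ n) {K L : Set (Eu n)} (h : DualPair K L) {C : ℝ≥0∞}
    (hB1 : Bnd C K L) (hB2 : Bnd C L K) {y0 ξ x0 q : Eu n} {δ t : ℝ}
    (hδ : 0 < δ) (hy0 : y0 ∈ L) (hx0 : x0 ∈ K) (hq : q ∈ K) (hyx0 : ⟪y0, x0⟫ = 1)
    (hyq : ⟪y0, q⟫ = 1) (hξx0 : ⟪ξ, x0⟫ = δ) (hξq : ⟪ξ, q⟫ = -δ)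
    (hF : ∀ x ∈ K, ⟪y0, x⟫ = 1 → ⟪ξ, x⟫ ≤ δ) (ht : 0 < t) (htδ : t ≤ δ) :
    ∃ (X V z : ℝ), 0 < X ∧ 0 ≤ V ∧ δ / (4 * n * t) ≤ z ∧
      ENNReal.ofReal V * volume (OpA n) ≤
        C * (ENNReal.ofReal ((4 * n) ^ (n-1) * X) * volume (Cube n 1)) ∧
      ENNReal.ofReal ((1/4) ^ (n-1) * z * X) * volume (OpB n) ≤
        C * (ENNReal.ofReal V * volume (Cube n 2)) := by
  have hn0 : (0:ℝ) < n := by positivity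
  have hn2 : (2:ℝ) ≤ n := by exact_mod_cast hn
  obtain ⟨ε1, hε1, hε1F⟩ := eps_exists h hy0 hδ ht hF
  set ε := min ε1 (min (1 / (n * (2 * δ))) (t / δ ^ 2)) with hεd
  have hε : 0 < ε := by positivity
  have hεa : ε ≤ ε1 := min_le_left _ _
  have hεb : ε * (n * (2 * δ)) ≤ 1 := by
    rw [← le_div_iff₀ (by positivity)]; exact (min_le_right _ _).trans (min_le_left _ _)
  have hεc : ε * δ ^ 2 ≤ t := by
    rw [← le_div_iff₀ (by positivity)]; exact (min_le_right _ _).trans (min_le_right _ _)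
  set w := y0 + ε • ξ with hw
  have hwi : ∀ x, ⟪w, x⟫ = ⟪y0, x⟫ + ε * ⟪ξ, x⟫ := by
    intro x; rw [hw, inner_add_left, inner_smul_left]; simp
  have hle1 : ∀ x ∈ K, ⟪y0, x⟫ ≤ 1 := fun x hx => by rw [real_inner_comm]; exact h.le hx hy0
  set m0 := ε * δ with hm0d
  set m := ε * (δ + t) with hmd
  have hm0 : 0 < m0 := by positivity
  have hm : 0 < m := by positivity
  have hmm0 : m ≤ 2 * m0 := by rw [hmd, hm0d]; nlinarith
  have hnm0 : n * (2 * m0) ≤ 1 := by rw [hm0d]; linarith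
  have hm01 : 4 * m0 ≤ 1 := by nlinarith
  have hnm : n * m ≤ 1 := by nlinarith
  have hub : ∀ x ∈ K, 1 ≤ ⟪w, x⟫ → ⟪ξ, x⟫ ≤ δ + t := hε1F ε hε hεa
  have hKw : ∀ x ∈ K, ⟪w, x⟫ ≤ 1 + m := by
    intro x hx
    by_cases hc : 1 ≤ ⟪w, x⟫
    · have e1 := hub x hx hc
      have e2 := hle1 x hx
      rw [hwi, hmd]
      nlinarith
    · linarith
  have hx0w : ⟪w, x0⟫ = 1 + m0 := by rw [hwi, hyx0, hξx0]
  set S : Set (Eu n) := K ∩ {x | ⟪w, x⟫ = 1} with hS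
  have hSc : IsCompact S := h.cK.inter_right (isClosed_eq (by fun_prop) continuous_const)
  obtain ⟨v, hvS, hDv, hcoord⟩ := exists_max hSc (span_slice h hx0 (by rw [hx0w]; linarith))
  obtain ⟨u, huv, hDD, hv, hu⟩ := exists_dual hDv
  have hvw : ∀ i, ⟪v i, w⟫ = 1 := fun i => by rw [real_inner_comm]; exact (hvS i).2
  have hwu : w = ∑ i, u i := by
    conv_lhs => rw [hu w]
    simp [hvw]
  have hSu : ∀ s ∈ S, ∀ i, |⟪u i, s⟫| ≤ 1 := by
    intro s hs i
    obtain ⟨c, hc, hsc⟩ := hcoord s hs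
    have : ⟪u i, s⟫ = c i := by
      rw [hsc, inner_sum]; simp [inner_smul_right, huv]
    rw [this]; exact hc i
  -- special points
  set x0' := (1 + m0)⁻¹ • x0 with hx0'
  have hx0'S : x0' ∈ S := by
    refine ⟨h.vK.smul_mem_of_zero_mem (interior_subset h.iK) hx0
      ⟨by positivity, inv_le_one_of_one_le₀ (by linarith)⟩, ?_⟩
    change ⟪w, (1 + m0)⁻¹ • x0⟫ = 1
    rw [inner_smul_right, hx0w, inv_mul_cancel₀ (by positivity)]
  have hξx0' : ⟪ξ, x0'⟫ = δ / (1 + m0) := by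
    rw [hx0', inner_smul_right, hξx0]; field_simp
  set q' : Eu n := (1/2 : ℝ) • x0 + (1/2 : ℝ) • q with hq'
  have hq'S : q' ∈ S := by
    refine ⟨h.vK hx0 hq (by norm_num) (by norm_num) (by norm_num), ?_⟩
    change ⟪w, (1/2 : ℝ) • x0 + (1/2 : ℝ) • q⟫ = 1
    rw [inner_add_right, inner_smul_right, inner_smul_right, hwi, hwi, hyx0, hyq, hξx0, hξq]; ring
  have hξq' : ⟪ξ, q'⟫ = 0 := by
    rw [hq', inner_add_right, inner_smul_right, inner_smul_right, hξx0, hξq]; ring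
  let i0 : Fin n := ⟨0, by omega⟩
  set ξc : Fin n → ℝ := fun i => ⟪v i, ξ⟫ with hξc
  obtain ⟨b, hb⟩ : ∃ b, δ / (4 * n) ≤ |ξc b - ξc i0| := by
    by_contra hcon
    push Not at hcon
    have hsum : ⟪ξ, x0' - q'⟫ = ∑ i, ⟪u i, x0' - q'⟫ * (ξc i - ξc i0) := by
      have e1 : ∑ i, ⟪u i, x0' - q'⟫ = 0 := by
        rw [← inner_w hwu, inner_sub_right]
        have e1 : ⟪w, x0'⟫ = 1 := hx0'S.2
        have e2 : ⟪w, q'⟫ = 1 := hq'S.2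
        rw [e1, e2, sub_self]
      simp_rw [mul_sub]
      rw [Finset.sum_sub_distrib, ← Finset.sum_mul, e1, zero_mul, sub_zero]
      conv_lhs => rw [hv (x0' - q'), inner_sum]
      apply Finset.sum_congr rfl
      intro i _
      rw [inner_smul_right, real_inner_comm (v i) ξ]
    have hlow : δ / 2 ≤ ⟪ξ, x0' - q'⟫ := by
      rw [inner_sub_right, hξx0', hξq', sub_zero]
      apply div_le_div_of_nonneg_left hδ.le (by positivity) (by linarith)
    have hupp : ∑ i, ⟪u i, x0' - q'⟫ * (ξc i - ξc i0) < ∑ i : Fin n, 2 * (δ / (4 * n)) := by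
      apply Finset.sum_lt_sum_of_nonempty ⟨i0, Finset.mem_univ _⟩
      intro i _
      have a1 : |⟪u i, x0' - q'⟫| ≤ 2 := by
        rw [inner_sub_right]
        have := abs_sub (⟪u i, x0'⟫) (⟪u i, q'⟫)
        linarith [hSu _ hx0'S i, hSu _ hq'S i]
      calc _ ≤ |⟪u i, x0' - q'⟫ * (ξc i - ξc i0)| := le_abs_self _
        _ = |⟪u i, x0' - q'⟫| * |ξc i - ξc i0| := abs_mul _ _
        _ ≤ 2 * |ξc i - ξc i0| := by gcongr
        _ < _ := by have := hcon i; linarith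
    have : ∑ i : Fin n, 2 * (δ / (4 * n)) = δ / 2 := by
      simp; field_simp; norm_num
    linarith
  have hbi0 : b ≠ i0 := by
    rintro rfl
    rw [sub_self, abs_zero] at hb
    have : 0 < δ / (4 * n) := by positivity
    linarith
  -- the family for part B
  set ζ : Fin n → Eu n := fun i => if i = b then t⁻¹ • ξ else u i with hζ
  set g : Fin n → Eu n := fun i => if i = i0 then w else w + (m0 / 4) • (ζ i - ⟪ζ i, x0'⟫ • w) with hg
  have hgi0 : g i0 = w := by simp [hg]
  have hgi : ∀ i, i ≠ i0 → g i = w + (m0 / 4) • (ζ i - ⟪ζ i, x0'⟫ • w) := by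
    intro i hi; simp [hg, hi]
  have hDg : DD g = (m0 / 4) ^ (n-1) * (t⁻¹ * ξc b - t⁻¹ * ξc i0) * DD u := by
    apply DD_B u hbi0 w hwu (m0 / 4) (fun i => t⁻¹ * ξc i)
      (fun i => if i = i0 then 0 else 1 - (m0/4) * ⟪ζ i, x0'⟫) (by simp) g hgi0
    · rw [hgi b hbi0]
      have e1 : ζ b = ∑ i, (t⁻¹ * ξc i) • u i := by
        simp only [hζ, if_true]
        conv_lhs => rw [hu ξ, Finset.smul_sum]
        simp_rw [smul_smul]
        rfl
      rw [← e1]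
      simp only [hbi0, if_false]
      module
    · intro i hi hib
      rw [hgi i hi]
      have e1 : ζ i = u i := by simp [hζ, hib]
      simp only [hi, if_false]
      rw [e1]
      module
  have hDu : DD u ≠ 0 := by
    intro h0; rw [h0, mul_zero] at hDD; exact zero_ne_one hDD
  have hdiff : |t⁻¹ * ξc b - t⁻¹ * ξc i0| = t⁻¹ * |ξc b - ξc i0| := by
    rw [← mul_sub, abs_mul, abs_of_pos (by positivity)]
  have hz : δ / (4 * n * t) ≤ t⁻¹ * |ξc b - ξc i0| := by
    calc δ / (4 * n * t) = t⁻¹ * (δ / (4 * n)) := by field_simp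
      _ ≤ _ := by gcongr
  have hzpos : 0 < t⁻¹ * |ξc b - ξc i0| := lt_of_lt_of_le (by positivity) hz
  have hDgabs : |DD g| = (1/4) ^ (n-1) * (t⁻¹ * |ξc b - ξc i0|) * (m0 ^ (n-1) * |DD u|) := by
    rw [hDg, abs_mul, abs_mul, hdiff, abs_of_pos (by positivity : 0 < (m0 / 4) ^ (n-1)),
      div_pow, one_div, inv_pow]
    field_simp
  have hDupos : 0 < |DD u| := abs_pos.2 hDu
  have hDg0 : DD g ≠ 0 := by
    rw [← abs_pos, hDgabs]; positivity
  have hζS : ∀ i, ∀ s ∈ S, ⟪ζ i, s⟫ - ⟪ζ i, x0'⟫ ≤ 2 := by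
    intro i s hs
    by_cases hib : i = b
    · have e1 : ζ i = t⁻¹ • ξ := by simp [hζ, hib]
      rw [e1, inner_smul_left, inner_smul_left, hξx0']
      simp only [conj_trivial]
      have e2 := hub s hs.1 (le_of_eq hs.2.symm)
      have e3 : δ - δ * m0 ≤ δ / (1 + m0) := by
        rw [le_div_iff₀ (by positivity)]
        have : 0 ≤ δ * m0 * m0 := by positivity
        nlinarith
      have e4 : δ * m0 ≤ t := by rw [hm0d]; nlinarith
      rw [← mul_sub, inv_mul_le_iff₀ ht]
      linarith
    · have e1 : ζ i = u i := by simp [hζ, hib]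
      rw [e1]
      have a1 := abs_le.1 (hSu s hs i)
      have a2 := abs_le.1 (hSu _ hx0'S i)
      linarith [a1.2, a2.1]
  have hgin : ∀ i, i ≠ i0 → ∀ x, ⟪g i, x⟫ = ⟪w, x⟫ + m0 / 4 * (⟪ζ i, x⟫ - ⟪ζ i, x0'⟫ * ⟪w, x⟫) := by
    intro i hi x
    rw [hgi i hi, inner_add_left, inner_smul_left, inner_sub_left, inner_smul_left]
    simp
  have hx0g : ∀ i, ⟪g i, x0⟫ = 1 + m0 := by
    intro i
    by_cases hi : i = i0
    · rw [hi, hgi0, hx0w]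
    · rw [hgin i hi, hx0w, hx0', inner_smul_right]
      field_simp
      ring
  have hSg : ∀ s ∈ K, ⟪w, s⟫ = 1 → ∀ i, ⟪g i, s⟫ ≤ 1 + m0 / 2 := by
    intro s hs hws i
    by_cases hi : i = i0
    · rw [hi, hgi0, hws]; linarith
    · rw [hgin i hi, hws, mul_one]
      have := hζS i s ⟨hs, hws⟩
      nlinarith
  have hA := partA hn h hB1 i0 huv hv hu (fun i => (hvS i).1) hwu hm hnm hKw
  have hBB := partB h hB2 i0 hv (fun s hs hws => hSu s ⟨hs, hws⟩) hm0 (by linarith)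
    (fun x hx => (hKw x hx).trans (by linarith)) hx0 hx0w hDg0 hx0g hSg
  refine ⟨m0 ^ (n-1) * |DD u|, |DD v|, t⁻¹ * |ξc b - ξc i0|, by positivity, abs_nonneg _, hz, ?_, ?_⟩
  · refine hA.trans ?_
    have e1 : (2 * n * m) ^ (n-1) * |DD u| ≤ (4 * n) ^ (n-1) * (m0 ^ (n-1) * |DD u|) := by
      rw [← mul_assoc (((4:ℝ) * n) ^ (n-1)), ← mul_pow]
      apply mul_le_mul_of_nonneg_right _ hDupos.le
      apply pow_le_pow_left₀ (by positivity)
      nlinarith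
    have e2 := ENNReal.ofReal_le_ofReal e1
    exact mul_le_mul_right (mul_le_mul_left e2 _) _
  · rw [← hDgabs]; exact hBB

lemma no_segment {n : ℕ} (hn : 2 ≤ n) {K L : Set (Eu n)} (h : DualPair K L) {C : ℝ≥0∞}
    (hC : C ≠ ∞) (hB1 : Bnd C K L) (hB2 : Bnd C L K) {a b : Eu n} (hab : a ≠ b) :
    ¬ segment ℝ a b ⊆ frontier K := by
  intro hseg
  obtain ⟨y0, ξ, x0, q, δ, hδ, hy0, hx0, hq, h1, h2, h3, h4, h5⟩ := seg_setup h hab hseg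
  have hn0 : (0:ℝ) < n := by positivity
  set k1 := volume.real (OpA n) with hk1
  set k2 := volume.real (OpB n) with hk2
  set k3 := volume.real (Cube n 1) with hk3
  set k4 := volume.real (Cube n 2) with hk4
  have p1 : 0 < k1 := ENNReal.toReal_pos (OpA_pos hn).ne' (OpA_fin n).ne
  have p2 : 0 < k2 := ENNReal.toReal_pos (OpB_pos hn).ne' (OpB_fin n).ne
  have p3 : 0 ≤ k3 := measureReal_nonneg
  have p4 : 0 ≤ k4 := measureReal_nonneg
  set c := C.toReal with hc
  have hc0 : 0 ≤ c := ENNReal.toReal_nonneg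
  set M : ℝ := c * k4 * (c * ((4 * n) ^ (n-1) * k3)) / (k1 * ((1/4) ^ (n-1) * k2)) * (4 * n) with hM
  have key : ∀ t, 0 < t → t ≤ δ → δ ≤ M * t := by
    intro t ht htδ
    obtain ⟨X, V, z, hX, hV, hz, hA, hB⟩ :=
      one_step hn h hB1 hB2 hδ hy0 hx0 hq h1 h2 h3 h4 h5 ht htδ
    have hz0 : 0 < z := lt_of_lt_of_le (by positivity) hz
    have f3 := (Cube_fin n 1).ne
    have f4 := (Cube_fin n 2).ne
    have hA' := ENNReal.toReal_mono (by finiteness) hA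
    have hB' := ENNReal.toReal_mono (by finiteness) hB
    simp only [ENNReal.toReal_mul] at hA' hB'
    rw [ENNReal.toReal_ofReal hV, ENNReal.toReal_ofReal (by positivity)] at hA'
    rw [ENNReal.toReal_ofReal hV, ENNReal.toReal_ofReal (by positivity)] at hB'
    change V * k1 ≤ c * ((4 * n) ^ (n-1) * X * k3) at hA'
    change (1/4) ^ (n-1) * z * X * k2 ≤ c * (V * k4) at hB'
    have e1 : (1/4) ^ (n-1) * z * X * k2 * k1 ≤ c * k4 * (c * ((4 * n) ^ (n-1) * X * k3)) := by
      calc _ ≤ c * (V * k4) * k1 := by gcongr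
        _ = c * k4 * (V * k1) := by ring
        _ ≤ _ := by gcongr
    have e2 : z ≤ c * k4 * (c * ((4 * n) ^ (n-1) * k3)) / (k1 * ((1/4) ^ (n-1) * k2)) := by
      rw [le_div_iff₀ (by positivity)]
      apply le_of_mul_le_mul_right _ hX
      linarith
    have e3 := hz.trans e2
    rw [div_le_iff₀ (by positivity)] at e3
    rw [hM]; linarith
  have hM0 : 0 ≤ M := by positivity
  have hk := key (min δ (δ / (2 * (M + 1)))) (by positivity) (min_le_left _ _)
  have hk2 : M * min δ (δ / (2 * (M + 1))) ≤ M * (δ / (2 * (M + 1))) := by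
    gcongr; exact min_le_right _ _
  have hk3 : M * (δ / (2 * (M + 1))) < δ := by
    rw [mul_div_assoc', div_lt_iff₀ (by positivity)]; nlinarith
  linarith


lemma smooth_of_no_segment {n : ℕ} {K L : Set (Eu n)} (h : DualPair K L)
    (hL : ∀ a b : Eu n, a ≠ b → ¬ segment ℝ a b ⊆ frontier L) : IsSmoothBody K := by
  intro x hx
  obtain ⟨hxK, y, hy, hxy⟩ := (h.frontier_iff x).1 hx
  have hy0 : y ≠ 0 := by
    rintro rfl; rw [inner_zero_right] at hxy; exact zero_ne_one hxy
  have hyx : ⟪y, x⟫ = 1 := by rw [real_inner_comm]; exact hxy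
  have huniq : ∀ z ∈ L, ⟪z, x⟫ = 1 → z = y := by
    intro z hz hzx
    by_contra hne
    apply hL z y hne
    rintro _ ⟨s, t, hs, ht, hst, rfl⟩
    rw [h.symm.frontier_iff]
    refine ⟨h.vL hz hy hs ht hst, x, hxK, ?_⟩
    rw [inner_add_left, inner_smul_left, inner_smul_left, hzx, hyx]
    simp [hst]
  have hspan : Submodule.span ℝ (normalCone K x) = Submodule.span ℝ {y} := by
    apply le_antisymm
    · rw [Submodule.span_le]
      intro z hz
      have hz' : ∀ w ∈ K, ⟪z, w⟫ ≤ ⟪z, x⟫ := hz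
      by_cases hz0 : z = 0
      · rw [hz0]; exact Submodule.zero_mem _
      have hpos : 0 < ⟪z, x⟫ := by
        obtain ⟨r, hr, hrK⟩ := ball_of_int h.iK
        have hzn : 0 < ‖z‖ := norm_pos_iff.2 hz0
        have hm : (r / (2 * ‖z‖)) • z ∈ K := by
          apply hrK
          rw [mem_ball_zero_iff, norm_smul, Real.norm_of_nonneg (by positivity)]
          field_simp; linarith
        have h1 := hz' _ hm
        rw [inner_smul_right, real_inner_self_eq_norm_sq] at h1
        have : 0 < r / (2 * ‖z‖) * ‖z‖ ^ 2 := by positivity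
        linarith
      have hin : ∀ w, ⟪⟪z, x⟫⁻¹ • z, w⟫ = ⟪z, x⟫⁻¹ * ⟪z, w⟫ := by
        intro w; rw [inner_smul_left]; simp
      have he : ⟪z, x⟫⁻¹ • z = y := by
        apply huniq
        · rw [h.hL]
          intro w hw
          rw [real_inner_comm, hin, inv_mul_le_iff₀ hpos, mul_one]
          exact hz' w hw
        · rw [hin, inv_mul_cancel₀ hpos.ne']
      have : z = ⟪z, x⟫ • y := by
        rw [← he, smul_smul, mul_inv_cancel₀ hpos.ne', one_smul]
      rw [this]
      exact Submodule.smul_mem _ _ (Submodule.mem_span_singleton_self y)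
    · rw [Submodule.span_singleton_le_iff_mem]
      apply Submodule.subset_span
      intro w hw
      rw [hyx, real_inner_comm]
      exact h.le hw hy
  unfold IsSmoothPt
  rw [hspan]
  exact finrank_span_singleton hy0


end Helpers

/-- **Theorem 1.2 (iii).** If `p ≤ 2 - n`, then `o ∈ int K`; consequently `K` is smooth
and strictly convex (its boundary contains no nondegenerate segment). -/
theorem stmt2 {n : ℕ} (hn : 2 ≤ n) {p : ℝ} (hp : p ≤ 2 - (n : ℝ)) {τ1 τ2 : ℝ}
    (hτ1 : 0 < τ1) (hτ12 : τ1 < τ2) {f : EuclideanSpace ℝ (Fin n) → ℝ}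
    (hf : ∀ u ∈ unitSphere n, τ1 < f u ∧ f u < τ2)
    {K : Set (EuclideanSpace ℝ (Fin n))} (hK : IsConvexBody0 K)
    (hsol : IsLpSolution p f K) :
    (0 : EuclideanSpace ℝ (Fin n)) ∈ interior K ∧ IsSmoothBody K ∧
      ∀ x y : EuclideanSpace ℝ (Fin n), x ≠ y → ¬ segment ℝ x y ⊆ frontier K := by
  have h0 := zero_mem_interior hn hp hτ1 hf hK hsol
  have hd := dualPair_polar hK.1 hK.2.1 h0
  obtain ⟨C, hC, hB1, hB2⟩ := bnd_of_sol hn hp hτ1 hf hd hsol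
  exact ⟨h0, smooth_of_no_segment hd fun a b hab => no_segment hn hd.symm hC hB2 hB1 hab,
    fun x y hxy => no_segment hn hd hC hB1 hB2 hxy⟩
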